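/- arXiv:2109.08550 — 5 statements merged into one kernel-verified Lean document; each statement's English description precedes it below -/
import Mathlib

section
/- There exist 3×3 complex matrices T_1, T_2 with T_1 T_2 = T_2 T_1 and ‖T_1 T_1^* + T_2 T_2^*‖ ≤ 1 such that ‖T_1² + T_2²‖ > 1. (Note that sup_{z ∈ 𝔹_2} |z_1² + z_2²| = 1, so this shows the von Neumann inequality with constant 1 fails for commuting 3×3 row contractions in two variables.) -/
open Metric MvPolynomial
open scoped Matrix

/-- The operator norm (with respect to the Euclidean/ℓ² norms) of a complex matrix. -/
noncomputable def matOpNorm {m : Type*} [Fintype m] [DecidableEq m] (A : Matrix m m ℂ) : ℝ :=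
  ‖Matrix.toEuclideanCLM (𝕜 := ℂ) A‖

/-- The action of `Matrix.toEuclideanCLM` on Euclidean norms, in coordinates. -/
lemma norm_sq_toEuclideanCLM_apply {m : Type*} [Fintype m] [DecidableEq m]
    (A : Matrix m m ℂ) (x : EuclideanSpace ℂ m) :
    ‖Matrix.toEuclideanCLM (𝕜 := ℂ) A x‖ ^ 2 = ∑ i, Complex.normSq (∑ j, A i j * x j) := by
  rw [EuclideanSpace.norm_sq_eq]
  refine Finset.sum_congr rfl fun i _ => ?_
  rw [Complex.normSq_eq_norm_sq]
  rfl

lemma matOpNorm_le_one_of_normSq {m : Type*} [Fintype m] [DecidableEq m] {A : Matrix m m ℂ}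
    (h : ∀ x : m → ℂ, ∑ i, Complex.normSq (∑ j, A i j * x j) ≤ ∑ i, Complex.normSq (x i)) :
    matOpNorm A ≤ 1 := by
  refine ContinuousLinearMap.opNorm_le_bound _ zero_le_one fun x => ?_
  rw [one_mul]
  refine le_of_sq_le_sq ?_ (norm_nonneg x)
  rw [norm_sq_toEuclideanCLM_apply, EuclideanSpace.norm_sq_eq]
  simpa only [Complex.normSq_eq_norm_sq] using h x

lemma one_lt_matOpNorm_of_normSq {m : Type*} [Fintype m] [DecidableEq m] {A : Matrix m m ℂ}
    (x : m → ℂ)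
    (h : ∑ i, Complex.normSq (x i) < ∑ i, Complex.normSq (∑ j, A i j * x j)) :
    1 < matOpNorm A := by
  by_contra! hA
  have hle := (Matrix.toEuclideanCLM (𝕜 := ℂ) A).le_of_opNorm_le hA (WithLp.toLp 2 x)
  rw [one_mul] at hle
  have hsq := pow_le_pow_left₀ (norm_nonneg _) hle 2
  rw [norm_sq_toEuclideanCLM_apply, EuclideanSpace.norm_sq_eq] at hsq
  simp only [← Complex.normSq_eq_norm_sq] at hsq
  exact absurd hsq (not_le.mpr h)

lemma sum_sq_le_of_gram (a b c : ℝ) :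
    (119 * a - 3 * b + 39 * c) ^ 2 + (-3 * a + 126 * b + 12 * c) ^ 2
      + (39 * a + 12 * b + 34 * c) ^ 2 ≤ 144 ^ 2 * (a ^ 2 + b ^ 2 + c ^ 2) := by
  nlinarith [sq_nonneg (5045 * a + 267 * b - 5931 * c),
    sq_nonneg (23675526 * b - 7512558 * c), sq_nonneg c]

/-- The first matrix of the counterexample. -/
noncomputable def counterexampleFst : Matrix (Fin 3) (Fin 3) ℂ :=
  (1 / 12 : ℂ) • !![3, 6, -3; 0, 0, -9; 0, 0, -3]

/-- The second matrix of the counterexample. -/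
noncomputable def counterexampleSnd : Matrix (Fin 3) (Fin 3) ℂ :=
  (Complex.I / 12) • !![-5, 2, -6; 0, -6, 3; 0, 0, -5]

lemma counterexample_comm :
    counterexampleFst * counterexampleSnd = counterexampleSnd * counterexampleFst := by
  unfold counterexampleFst counterexampleSnd
  rw [smul_mul_smul_comm, smul_mul_smul_comm, mul_comm (1 / 12 : ℂ)]
  congr 1
  ext i j
  fin_cases i <;> fin_cases j <;> simp [Matrix.mul_apply, Fin.sum_univ_three] <;>
    norm_num

lemma counterexample_gram :
    counterexampleFst * counterexampleFstᴴ + counterexampleSnd * counterexampleSndᴴ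
      = (1 / 144 : ℂ) • !![119, -3, 39; -3, 126, 12; 39, 12, 34] := by
  ext i j
  simp only [counterexampleFst, counterexampleSnd, Matrix.add_apply, Matrix.mul_apply,
    Matrix.conjTranspose_apply, Fin.sum_univ_three]
  fin_cases i <;> fin_cases j <;> simp <;> ring_nf <;> norm_num [Complex.I_sq]

lemma counterexample_sq :
    counterexampleFst ^ 2 + counterexampleSnd ^ 2
      = (1 / 144 : ℂ) • !![-16, 40, -120; 0, -36, 60; 0, 0, -16] := by
  ext i j
  simp only [counterexampleFst, counterexampleSnd, sq, Matrix.add_apply, Matrix.mul_apply,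
    Fin.sum_univ_three]
  fin_cases i <;> fin_cases j <;> simp <;> ring_nf <;> norm_num [Complex.I_sq]

/-- There is a pair of commuting `3 × 3` matrices forming a row contraction for which
`‖T₁² + T₂²‖ > 1`, while `sup_{z ∈ 𝔹₂} |z₁² + z₂²| = 1`. -/
theorem exists_three_by_three_row_contraction_vonNeumann_fails :
    ∃ T₁ T₂ : Matrix (Fin 3) (Fin 3) ℂ,
      T₁ * T₂ = T₂ * T₁ ∧
      matOpNorm (T₁ * T₁ᴴ + T₂ * T₂ᴴ) ≤ 1 ∧
      1 < matOpNorm (T₁ ^ 2 + T₂ ^ 2) := by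
  refine ⟨counterexampleFst, counterexampleSnd, counterexample_comm, ?_, ?_⟩
  · rw [counterexample_gram]
    refine matOpNorm_le_one_of_normSq fun x => ?_
    have hre := sum_sq_le_of_gram (x 0).re (x 1).re (x 2).re
    have him := sum_sq_le_of_gram (x 0).im (x 1).im (x 2).im
    simp [Fin.sum_univ_three, Complex.normSq_apply]
    linarith
  · rw [counterexample_sq]
    refine one_lt_matOpNorm_of_normSq ![1, -3, 6] ?_
    simp [Fin.sum_univ_three, Complex.normSq_apply]
    norm_num
end

section
/- Let n, d ∈ ℕ with d > ⌊n²/4⌋ + 1, and let T = (T_1, …, T_d) be a d-tuple of pairwise commuting n×n complex matrices. Then there exists a unitary d×d complex matrix U = (u_{ji}) such that the d-tuple S = (S_1, …, S_d) defined by S_j = ∑_{i=1}^d u_{ji} T_i satisfies S_j = 0 for all j > ⌊n²/4⌋ + 1. (That is, after applying a unitary change of variables, at most the first ⌊n²/4⌋ + 1 matrices in the tuple are nonzero.) -/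
open scoped Matrix

open Module

section Schur

variable {K : Type*} [Field K]

/-- A commuting family of endomorphisms of a nonzero finite-dimensional space over an
algebraically closed field has a common eigenvector. -/
theorem exists_common_eigenvector_of_commute [IsAlgClosed K] {V : Type*} [AddCommGroup V]
    [Module K V] [FiniteDimensional K V] [Nontrivial V] (S : Set (End K V))
    (hS : ∀ A ∈ S, ∀ B ∈ S, A * B = B * A) :
    ∃ v : V, v ≠ 0 ∧ ∀ A ∈ S, ∃ c : K, A v = c • v := by
  induction hn : finrank K V using Nat.strong_induction_on generalizing V with
  | _ n ih =>
  subst hn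
  by_cases hscal : ∀ A ∈ S, ∃ c : K, End.eigenspace A c = ⊤
  · obtain ⟨v, hv⟩ := exists_ne (0 : V)
    refine ⟨v, hv, fun A hA => ?_⟩
    obtain ⟨c, hc⟩ := hscal A hA
    exact ⟨c, End.mem_eigenspace_iff.mp (hc ▸ Submodule.mem_top)⟩
  · push Not at hscal
    obtain ⟨A, hA, hne⟩ := hscal
    obtain ⟨c, hc⟩ := End.exists_eigenvalue A
    have hinv : ∀ B ∈ S, ∀ x ∈ End.eigenspace A c, B x ∈ End.eigenspace A c := by
      intro B hB x hx
      rw [End.mem_eigenspace_iff] at hx ⊢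
      rw [← End.mul_apply, hS A hA B hB, End.mul_apply, hx, map_smul]
    have : Nontrivial (End.eigenspace A c) := Submodule.nontrivial_iff_ne_bot.mpr hc
    obtain ⟨v, hv, hvS⟩ := ih _ (Submodule.finrank_lt (hne c))
      (Set.range fun B : S => (B : End K V).restrict (hinv B B.2))
      (by
        rintro _ ⟨B, rfl⟩ _ ⟨C, rfl⟩
        ext x
        exact congrArg (fun D : End K V => D x) (hS B B.2 C C.2)) rfl
    refine ⟨v, by simpa using hv, fun B hB => ?_⟩
    obtain ⟨b, hb⟩ := hvS _ ⟨⟨B, hB⟩, rfl⟩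
    exact ⟨b, congrArg Subtype.val hb⟩

variable {V : Type*} [AddCommGroup V] [Module K V]

/-- Restriction of a space of endomorphisms to an invariant subspace, as a linear map. -/
def restrictInvariant (W : Submodule K (End K V)) (p : Submodule K V)
    (h : ∀ A ∈ W, ∀ x ∈ p, A x ∈ p) : W →ₗ[K] End K p where
  toFun A := (A : End K V).restrict (h A A.2)
  map_add' _ _ := rfl
  map_smul' _ _ := rfl

/-- The action of a space of endomorphisms on the quotient by an invariant subspace,
as a linear map. -/
def quotientInvariant (W : Submodule K (End K V)) (p : Submodule K V)
    (h : ∀ A ∈ W, ∀ x ∈ p, A x ∈ p) : W →ₗ[K] End K (V ⧸ p) where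
  toFun A := p.mapQ p A (h A A.2)
  map_add' _ _ := by ext; rfl
  map_smul' _ _ := by ext; rfl

/-- If the linear forms in `P` vanish on `Q`, then `dim P + dim Q ≤ dim V`. -/
theorem finrank_add_finrank_le_of_annihilate [FiniteDimensional K V]
    {P : Submodule K (Dual K V)} {Q : Submodule K V} (h : ∀ f ∈ P, ∀ x ∈ Q, f x = 0) :
    finrank K P + finrank K Q ≤ finrank K V := by
  have hP : P ≤ Q.dualAnnihilator := fun f hf =>
    (Submodule.mem_dualAnnihilator f).mpr (h f hf)
  have := Submodule.finrank_mono hP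
  have := Subspace.finrank_add_finrank_dualAnnihilator_eq Q
  omega

/-- Schur's bound on the dimension of a space of commuting endomorphisms. -/
theorem finrank_le_of_commute [IsAlgClosed K] [FiniteDimensional K V]
    (W : Submodule K (End K V)) (hW : ∀ A ∈ W, ∀ B ∈ W, A * B = B * A) :
    finrank K W ≤ finrank K V ^ 2 / 4 + 1 := by
  induction hn : finrank K V generalizing V with
  | zero =>
    have := W.finrank_le
    rw [finrank_linearMap, hn] at this
    omega
  | succ n ih =>
  rcases Nat.eq_zero_or_pos n with rfl | hpos
  · have := W.finrank_le
    rw [finrank_linearMap, hn] at this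
    omega
  have : Nontrivial V := nontrivial_of_finrank_pos (R := K) (by omega)
  obtain ⟨φ, hφ, hφW⟩ := exists_common_eigenvector_of_commute
    (Set.range fun A : W => Dual.transpose (R := K) (A : End K V)) (by
      rintro _ ⟨A, rfl⟩ _ ⟨B, rfl⟩
      ext f x
      exact congrArg (fun D : End K V => f (D x)) (hW B B.2 A A.2))
  replace hφW : ∀ A ∈ W, ∃ c : K, ∀ x, φ (A x) = c * φ x := fun A hA => by
    obtain ⟨c, hc⟩ := hφW _ ⟨⟨A, hA⟩, rfl⟩
    exact ⟨c, fun x => LinearMap.congr_fun hc x⟩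
  have hker : ∀ A ∈ W, ∀ x ∈ LinearMap.ker φ, A x ∈ LinearMap.ker φ := by
    intro A hA x hx
    obtain ⟨c, hc⟩ := hφW A hA
    rw [LinearMap.mem_ker] at hx ⊢
    rw [hc, hx, mul_zero]
  have hHrank : finrank K (LinearMap.ker φ) = n := by
    have := Dual.finrank_ker_add_one_of_ne_zero hφ
    omega
  have : Nontrivial (LinearMap.ker φ) := nontrivial_of_finrank_pos (R := K) (by omega)
  have hres : ∀ A B : W, restrictInvariant W _ hker A * restrictInvariant W _ hker B =
      restrictInvariant W _ hker B * restrictInvariant W _ hker A := by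
    intro A B
    ext x
    exact congrArg (fun D : End K V => D x) (hW A A.2 B B.2)
  obtain ⟨⟨v, hvφ⟩, hv, hvW⟩ := exists_common_eigenvector_of_commute
    (Set.range (restrictInvariant W _ hker)) (by
      rintro _ ⟨A, rfl⟩ _ ⟨B, rfl⟩
      exact hres A B)
  replace hv : v ≠ 0 := fun h => hv (Subtype.ext h)
  replace hvW : ∀ A ∈ W, ∃ c : K, A v = c • v := fun A hA => by
    obtain ⟨c, hc⟩ := hvW _ ⟨⟨A, hA⟩, rfl⟩
    exact ⟨c, congrArg Subtype.val hc⟩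
  have hspan : ∀ A ∈ W, ∀ x ∈ K ∙ v, A x ∈ K ∙ v := by
    intro A hA x hx
    obtain ⟨a, rfl⟩ := Submodule.mem_span_singleton.mp hx
    obtain ⟨c, hc⟩ := hvW A hA
    rw [map_smul, hc]
    exact Submodule.smul_mem _ _ (Submodule.smul_mem _ _ (Submodule.mem_span_singleton_self v))
  have hLrank : finrank K (V ⧸ K ∙ v) = n := by
    have := Submodule.finrank_quotient_add_finrank (K ∙ v)
    rw [finrank_span_singleton hv] at this
    omega
  set ρ := restrictInvariant W _ hker
  set π := quotientInvariant W _ hspan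
  have hρrange := ih (LinearMap.range ρ) (by
    rintro _ ⟨A, rfl⟩ _ ⟨B, rfl⟩
    exact hres A B) hHrank
  have hπrange := ih (LinearMap.range π) (by
    rintro _ ⟨A, rfl⟩ _ ⟨B, rfl⟩
    ext x
    exact congrArg (fun D : End K V => (K ∙ v).mkQ (D x)) (hW A A.2 B B.2)) hLrank
  have hρker := LinearMap.finrank_range_add_finrank_ker ρ
  have hπker := LinearMap.finrank_range_add_finrank_ker π
  have hρ0 : ∀ A ∈ LinearMap.ker ρ, ∀ x, φ x = 0 → (A : End K V) x = 0 := by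
    intro A hA x hx
    exact congrArg Subtype.val (LinearMap.congr_fun (LinearMap.mem_ker.mp hA) ⟨x, hx⟩)
  have hπ0 : ∀ A ∈ LinearMap.ker π, ∀ x, (A : End K V) x ∈ K ∙ v := by
    intro A hA x
    exact (Submodule.Quotient.mk_eq_zero _).mp
      (LinearMap.congr_fun (LinearMap.mem_ker.mp hA) ((K ∙ v).mkQ x))
  obtain ⟨w, hw⟩ : ∃ w, φ w = 1 := LinearMap.surjective hφ 1
  obtain ⟨ψ, hψ⟩ : ∃ ψ : Dual K V, ψ v = 1 := Projective.exists_dual_eq_one K hv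
  let F : LinearMap.ker π →ₗ[K] Dual K V :=
    (LinearMap.compRight K ψ) ∘ₗ W.subtype ∘ₗ (LinearMap.ker π).subtype
  let G : LinearMap.ker ρ →ₗ[K] V :=
    (LinearMap.applyₗ w) ∘ₗ W.subtype ∘ₗ (LinearMap.ker ρ).subtype
  have hF : Function.Injective F := by
    rw [injective_iff_map_eq_zero]
    intro A hA
    refine Subtype.ext (Subtype.ext (LinearMap.ext fun x => ?_))
    obtain ⟨a, ha⟩ := Submodule.mem_span_singleton.mp (hπ0 A A.2 x)
    have h0 : ψ (((A : W) : End K V) x) = 0 := LinearMap.congr_fun hA x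
    rw [← ha, map_smul, hψ, smul_eq_mul, mul_one] at h0
    change ((A : W) : End K V) x = 0
    rw [← ha, h0, zero_smul]
  have hG : Function.Injective G := by
    rw [injective_iff_map_eq_zero]
    intro A hA
    refine Subtype.ext (Subtype.ext (LinearMap.ext fun x => ?_))
    have h0 : ((A : W) : End K V) w = 0 := hA
    have h1 := hρ0 A A.2 (x - φ x • w) (by simp [hw])
    rw [map_sub, map_smul, h0, smul_zero, sub_zero] at h1
    exact h1
  have hFG := finrank_add_finrank_le_of_annihilate
    (P := LinearMap.range F) (Q := LinearMap.range G) (by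
      rintro _ ⟨A, rfl⟩ _ ⟨B, rfl⟩
      change ψ (((A : W) : End K V) (((B : W) : End K V) w)) = 0
      obtain ⟨a, ha⟩ := Submodule.mem_span_singleton.mp (hπ0 A A.2 w)
      rw [← End.mul_apply, hW _ (A : W).2 _ (B : W).2, End.mul_apply, ← ha, map_smul,
        hρ0 B B.2 v hvφ, smul_zero, map_zero])
  rw [LinearMap.finrank_range_of_inj hF, LinearMap.finrank_range_of_inj hG, hn] at hFG
  obtain ⟨k, rfl | rfl⟩ := Nat.even_or_odd' n
  · have h1 : (2 * k) ^ 2 / 4 = k ^ 2 := by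
      rw [mul_pow]; omega
    have h2 : (2 * k + 1) ^ 2 / 4 = k ^ 2 + k := by
      ring_nf; omega
    omega
  · have h1 : (2 * k + 1) ^ 2 / 4 = k ^ 2 + k := by
      ring_nf; omega
    have h2 : (2 * k + 1 + 1) ^ 2 / 4 = k ^ 2 + 2 * k + 1 := by
      ring_nf; omega
    omega

end Schur

/-- Any subspace of `𝕜^d` of dimension at least `d - m` contains all rows of index at
least `m` of some unitary matrix. -/
theorem exists_unitary_rows_mem {d m : ℕ} (L : Submodule ℂ (EuclideanSpace ℂ (Fin d)))
    (hL : d ≤ m + finrank ℂ L) :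
    ∃ U : Matrix (Fin d) (Fin d) ℂ, U * Uᴴ = 1 ∧
      ∀ j : Fin d, m ≤ (j : ℕ) → WithLp.toLp 2 (U j) ∈ L := by
  let e := stdOrthonormalBasis ℂ L
  let v : Fin d → EuclideanSpace ℂ (Fin d) := fun j =>
    if h : (j : ℕ) - m < finrank ℂ L then e ⟨j - m, h⟩ else 0
  have hlt : ∀ j : Fin d, m ≤ (j : ℕ) → (j : ℕ) - m < finrank ℂ L := fun j _ => by omega
  have hv : Orthonormal ℂ (Set.domRestrict {j : Fin d | m ≤ (j : ℕ)} v) := by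
    have he := (e.orthonormal.comp_linearIsometry L.subtypeₗᵢ).comp
      (fun j : {j : Fin d | m ≤ (j : ℕ)} => (⟨(j : Fin d) - m, hlt j j.2⟩ : Fin _)) (by
        rintro ⟨i, hi⟩ ⟨j, hj⟩ hij
        simp only [Set.mem_ofPred_eq, Fin.mk.injEq] at hi hj hij
        ext
        simp only
        omega)
    convert he using 1
    funext j
    simp [v, hlt j j.2]
  obtain ⟨b, hb⟩ := hv.exists_orthonormalBasis_extension_of_card_eq (by simp)
  refine ⟨Matrix.of fun j i => b j i, ?_, fun j hj => ?_⟩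
  · ext i j
    have := orthonormal_iff_ite.mp b.orthonormal j i
    simp only [PiLp.inner_apply, RCLike.inner_apply] at this
    simp [Matrix.mul_apply, Matrix.one_apply, this, eq_comm]
  · change b j ∈ L
    rw [hb j hj]
    simp [v, hlt j hj]

/-- (Variable reduction via a theorem of Schur.) If `T = (T_1, …, T_d)` is a tuple of
pairwise commuting `n × n` complex matrices and `d > ⌊n²/4⌋ + 1`, then there is a unitary
`d × d` matrix `U = (u_{ji})` such that the tuple `S_j = ∑ᵢ u_{ji} T_i` has `S_j = 0` for
all `j > ⌊n²/4⌋ + 1` (indices of `Fin d` being counted from `1` to `d`). -/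
theorem variable_reduction (n d : ℕ) (hd : n ^ 2 / 4 + 1 < d)
    (T : Fin d → Matrix (Fin n) (Fin n) ℂ)
    (hcomm : ∀ i j, T i * T j = T j * T i) :
    ∃ U : Matrix (Fin d) (Fin d) ℂ,
      U * Uᴴ = 1 ∧ Uᴴ * U = 1 ∧
      ∀ j : Fin d, n ^ 2 / 4 + 1 ≤ (j : ℕ) → ∑ i, U j i • T i = 0 := by
  let f : EuclideanSpace ℂ (Fin d) →ₗ[ℂ] End ℂ (Fin n → ℂ) :=
    Fintype.linearCombination ℂ (fun i => Matrix.toLin' (T i)) ∘ₗ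
      (WithLp.linearEquiv 2 ℂ (Fin d → ℂ)).toLinearMap
  have hf : ∀ x, f x = ∑ i, x i • Matrix.toLin' (T i) := fun x => rfl
  have hrange : finrank ℂ (LinearMap.range f) ≤ n ^ 2 / 4 + 1 := by
    have := finrank_le_of_commute (LinearMap.range f) (by
      rintro _ ⟨x, rfl⟩ _ ⟨y, rfl⟩
      rw [hf, hf]
      refine Commute.sum_left _ _ _ fun i _ => Commute.sum_right _ _ _ fun j _ => ?_
      refine (Commute.smul_left ?_ _).smul_right _
      change _ * _ = _ * _
      rw [End.mul_eq_comp, End.mul_eq_comp, ← Matrix.toLin'_mul, ← Matrix.toLin'_mul, hcomm])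
    simpa using this
  have hrk := LinearMap.finrank_range_add_finrank_ker f
  rw [finrank_euclideanSpace_fin] at hrk
  obtain ⟨U, hU, hUL⟩ := exists_unitary_rows_mem (m := n ^ 2 / 4 + 1) (LinearMap.ker f)
    (by omega)
  refine ⟨U, hU, mul_eq_one_comm.mp hU, fun j hj => ?_⟩
  have h := LinearMap.mem_ker.mp (hUL j hj)
  rw [hf] at h
  apply Matrix.toLin'.injective
  simpa using h
end

section
/- Let d ∈ ℕ, a > 0 and c > 0. For z, w ∈ 𝔹_d set ⟨z,w⟩ = ∑_{i=1}^d z_i · conj(w_i) and define the Hermitian kernel L(z,w) = (1 − c²·⟨z,w⟩) · exp(−a · Log(1 − ⟨z,w⟩)), where Log is the principal branch of the complex logarithm (well defined since |⟨z,w⟩| < 1, so Re(1 − ⟨z,w⟩) > 0). Then L is a positive semidefinite kernel on 𝔹_d — i.e., for every m ∈ ℕ and all points z_1, …, z_m ∈ 𝔹_d the m×m matrix (L(z_i, z_j))_{i,j} is positive semidefinite — if and only if c² ≤ min(1, a). -/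
open Metric
open scoped ComplexOrder

/-- The inner product `⟨z,w⟩ = ∑ᵢ zᵢ conj(wᵢ)` on `ℂ^d`. -/
noncomputable def ballInner {d : ℕ} (z w : EuclideanSpace ℂ (Fin d)) : ℂ :=
  ∑ i, z i * (starRingEnd ℂ) (w i)

/-- The Hermitian kernel `L(z,w) = (1 − c²⟨z,w⟩) · (1 − ⟨z,w⟩)^{-a}`, where the power is
defined via the principal branch of the logarithm. -/
noncomputable def hermKernel {d : ℕ} (a c : ℝ) (z w : EuclideanSpace ℂ (Fin d)) : ℂ :=
  (1 - (c : ℂ) ^ 2 * ballInner z w) *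
    Complex.exp (-(a : ℂ) * Complex.log (1 - ballInner z w))

/-- A matrix that is an entrywise sum of positive semidefinite matrices is positive semidefinite. -/
theorem Matrix.PosSemidef.of_hasSum {ι κ : Type*} [Fintype ι] {A : κ → Matrix ι ι ℂ}
    {B : Matrix ι ι ℂ} (hA : ∀ k, (A k).PosSemidef)
    (h : ∀ i j, HasSum (fun k => A k i j) (B i j)) : B.PosSemidef := by
  refine Matrix.posSemidef_iff_dotProduct_mulVec.2 ⟨?_, fun x => ?_⟩
  · ext i j
    refine (h j i).star.unique ((h i j).congr_fun fun k => ?_)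
    exact (hA k).isHermitian.apply i j
  · have hs : HasSum (fun k => star x ⬝ᵥ (A k).mulVec x) (star x ⬝ᵥ B.mulVec x) :=
      hasSum_sum fun i _ => (hasSum_sum fun j _ => (h i j).mul_right (x j)).mul_left (star x i)
    exact hs.nonneg fun k => (Matrix.posSemidef_iff_dotProduct_mulVec.1 (hA k)).2 x

/-- The entrywise powers of a positive semidefinite matrix are positive semidefinite. -/
theorem Matrix.PosSemidef.map_pow {ι : Type*} [Fintype ι] {A : Matrix ι ι ℂ}
    (hA : A.PosSemidef) (n : ℕ) : (A.map (· ^ n)).PosSemidef := by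
  induction n with
  | zero =>
    convert! Matrix.posSemidef_vecMulVec_self_star (fun _ : ι => (1 : ℂ)) using 1
    ext i j
    simp [Matrix.vecMulVec_apply]
  | succ n ih =>
    convert! ih.hadamard hA using 1

/-- A power series with nonnegative coefficients preserves positive semidefiniteness when applied
entrywise. -/
theorem Matrix.PosSemidef.of_hasSum_pow {ι : Type*} [Fintype ι] {A B : Matrix ι ι ℂ}
    (hA : A.PosSemidef) {b : ℕ → ℝ} (hb : ∀ n, 0 ≤ b n)
    (h : ∀ i j, HasSum (fun n => (b n : ℂ) * A i j ^ n) (B i j)) : B.PosSemidef :=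
  Matrix.PosSemidef.of_hasSum (A := fun n => (b n : ℂ) • A.map (· ^ n))
    (fun n => (hA.map_pow n).smul (Complex.zero_le_real.2 (hb n))) h

/-- The entrywise exponential of a positive semidefinite matrix is positive semidefinite. -/
theorem Matrix.PosSemidef.map_exp {ι : Type*} [Fintype ι] {A : Matrix ι ι ℂ}
    (hA : A.PosSemidef) : (A.map Complex.exp).PosSemidef := by
  refine hA.of_hasSum_pow (b := fun n => ((n.factorial : ℝ))⁻¹) (fun n => by positivity) ?_
  intro i j
  have h := NormedSpace.expSeries_div_hasSum_exp (A i j)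
  rw [← Complex.exp_eq_exp_ℂ] at h
  refine h.congr_fun fun n => ?_
  push_cast
  rw [div_eq_inv_mul]

theorem norm_ballInner_lt_one {d : ℕ} {z w : EuclideanSpace ℂ (Fin d)}
    (hz : z ∈ ball (0 : EuclideanSpace ℂ (Fin d)) 1)
    (hw : w ∈ ball (0 : EuclideanSpace ℂ (Fin d)) 1) : ‖ballInner z w‖ < 1 := by
  have h : ballInner z w = inner ℂ w z := by
    simp [ballInner, PiLp.inner_apply]
  rw [mem_ball_zero_iff] at hz hw
  rw [h]
  refine (norm_inner_le_norm w z).trans_lt ?_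
  nlinarith [norm_nonneg z, norm_nonneg w]

theorem posSemidef_ballInner {d m : ℕ} (z : Fin m → EuclideanSpace ℂ (Fin d)) :
    (Matrix.of fun i j => ballInner (z i) (z j)).PosSemidef :=
  Matrix.posSemidef_self_mul_conjTranspose (Matrix.of fun i k => z i k)

/-- The Taylor series of `log ((1 - q u) / (1 - u) ^ a)`. -/
theorem hasSum_log_one_sub_mul_sub {a q : ℝ} (hq0 : 0 ≤ q) (hq1 : q ≤ 1) {u : ℂ} (hu : ‖u‖ < 1) :
    HasSum (fun n : ℕ => (((a - q ^ n) / n : ℝ) : ℂ) * u ^ n)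
      (Complex.log (1 - q * u) - a * Complex.log (1 - u)) := by
  have hqu : ‖(q : ℂ) * u‖ < 1 := by
    rw [norm_mul, Complex.norm_real, Real.norm_of_nonneg hq0]
    nlinarith [norm_nonneg u]
  have h := ((Complex.hasSum_taylorSeries_neg_log hu).mul_left (a : ℂ)).sub
    (Complex.hasSum_taylorSeries_neg_log hqu)
  convert! h using 1
  · ext n
    push_cast
    ring
  · ring

theorem posSemidef_hermKernel {d m : ℕ} {a c : ℝ} (h : c ^ 2 ≤ min 1 a)
    {z : Fin m → EuclideanSpace ℂ (Fin d)}
    (hz : ∀ i, z i ∈ ball (0 : EuclideanSpace ℂ (Fin d)) 1) :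
    (Matrix.of fun i j => hermKernel a c (z i) (z j)).PosSemidef := by
  obtain ⟨h1, ha⟩ := le_min_iff.1 h
  have hlog : (Matrix.of fun i j => Complex.log (1 - (c ^ 2 : ℝ) * ballInner (z i) (z j))
      - a * Complex.log (1 - ballInner (z i) (z j))).PosSemidef := by
    refine (posSemidef_ballInner z).of_hasSum_pow (b := fun n => (a - (c ^ 2) ^ n) / n) ?_
      fun i j => hasSum_log_one_sub_mul_sub (sq_nonneg c) h1 (norm_ballInner_lt_one (hz i) (hz j))
    intro n
    rcases eq_or_ne n 0 with rfl | hn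
    · simp
    · have := pow_le_of_le_one (sq_nonneg c) h1 hn
      exact div_nonneg (by linarith) n.cast_nonneg
  convert! hlog.map_exp using 1
  ext i j
  have hu := norm_ballInner_lt_one (hz i) (hz j)
  have hne : 1 - ((c ^ 2 : ℝ) : ℂ) * ballInner (z i) (z j) ≠ 0 := by
    intro h0
    have h2 := congrArg norm (sub_eq_zero.1 h0)
    rw [norm_one, norm_mul, Complex.norm_real, Real.norm_of_nonneg (sq_nonneg c)] at h2
    nlinarith [norm_nonneg (ballInner (z i) (z j))]
  simp only [Matrix.of_apply, Matrix.map_apply, hermKernel]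
  rw [sub_eq_add_neg (Complex.log _), Complex.exp_add, Complex.exp_log hne, neg_mul]
  push_cast
  rfl

/-- Testing positivity at the points `0` and `√x e₁`. -/
theorem one_le_of_posSemidef_hermKernel {d : ℕ} (hd : 1 ≤ d) {a c : ℝ}
    (h : ∀ (m : ℕ) (z : Fin m → EuclideanSpace ℂ (Fin d)),
        (∀ i, z i ∈ ball (0 : EuclideanSpace ℂ (Fin d)) 1) →
        (Matrix.of fun i j : Fin m => hermKernel a c (z i) (z j)).PosSemidef)
    {x : ℝ} (hx0 : 0 < x) (hx1 : x < 1) :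
    1 ≤ (1 - c ^ 2 * x) * Real.exp (-a * Real.log (1 - x)) := by
  set v : EuclideanSpace ℂ (Fin d) := EuclideanSpace.single ⟨0, hd⟩ ((√x : ℝ) : ℂ) with hv
  have hvv : ballInner v v = (x : ℂ) := by
    have : ((√x : ℝ) : ℂ) * (√x : ℝ) = x := by
      rw [← Complex.ofReal_mul, Real.mul_self_sqrt hx0.le]
    simp [ballInner, hv, this]
  have h00 : hermKernel a c (0 : EuclideanSpace ℂ (Fin d)) 0 = 1 := by simp [hermKernel, ballInner]
  have h0v : hermKernel a c 0 v = 1 := by simp [hermKernel, ballInner]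
  have hv0 : hermKernel a c v 0 = 1 := by simp [hermKernel, ballInner]
  have hL : hermKernel a c v v
      = (((1 - c ^ 2 * x) * Real.exp (-a * Real.log (1 - x)) : ℝ) : ℂ) := by
    rw [hermKernel, hvv]
    push_cast
    rw [Complex.ofReal_log (by linarith)]
    push_cast
    rfl
  have hball : ∀ i, ![0, v] i ∈ ball (0 : EuclideanSpace ℂ (Fin d)) 1 := by
    intro i
    fin_cases i
    · simp
    · simpa [hv, abs_of_nonneg (Real.sqrt_nonneg x), Real.sqrt_lt' one_pos] using hx1
  have hp := (Matrix.posSemidef_iff_dotProduct_mulVec.1 (h 2 ![0, v] hball)).2 ![1, -1]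
  simp [Matrix.mulVec, dotProduct, Fin.sum_univ_two, h00, h0v, hv0, hL, -Complex.ofReal_mul] at hp
  rw [neg_mul]
  exact_mod_cast hp

/-- The kernel `(1 − c²⟨z,w⟩)/(1 − ⟨z,w⟩)^a` is positive semidefinite on `𝔹_d`
(equivalently, the row `(c z₁, …, c z_d)` is a contractive multiplier of the space with
kernel `(1 − ⟨z,w⟩)^{-a}`) if and only if `c² ≤ min(1, a)`. -/
theorem hermKernel_posSemidef_iff (d : ℕ) (hd : 1 ≤ d) (a c : ℝ) (ha : 0 < a) (hc : 0 < c) :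
    (∀ (m : ℕ) (z : Fin m → EuclideanSpace ℂ (Fin d)),
        (∀ i, z i ∈ ball (0 : EuclideanSpace ℂ (Fin d)) 1) →
        (Matrix.of fun i j : Fin m => hermKernel a c (z i) (z j)).PosSemidef)
      ↔ c ^ 2 ≤ min 1 a := by
  refine ⟨fun h => ?_, fun h m z hz => posSemidef_hermKernel h hz⟩
  have hc2 : 0 < c ^ 2 := by positivity
  have key := fun {x : ℝ} => one_le_of_posSemidef_hermKernel hd h (x := x)
  refine le_min ?_ ?_
  · by_contra! hlt
    have hinv : (c ^ 2)⁻¹ < 1 := inv_lt_one_of_one_lt₀ hlt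
    have hpos : 0 < (c ^ 2)⁻¹ := by positivity
    have hmul : c ^ 2 * (c ^ 2)⁻¹ = 1 := mul_inv_cancel₀ hc2.ne'
    have hk := key (x := ((c ^ 2)⁻¹ + 1) / 2) (by linarith) (by linarith)
    nlinarith [Real.exp_pos (-a * Real.log (1 - ((c ^ 2)⁻¹ + 1) / 2))]
  · by_contra! hlt
    have hdiv : a / c ^ 2 < 1 := (div_lt_one hc2).2 hlt
    have hpos : 0 < a / c ^ 2 := by positivity
    have hmul : c ^ 2 * (a / c ^ 2) = a := mul_div_cancel₀ a hc2.ne'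
    obtain ⟨x, hx⟩ : ∃ x, x = (1 - a / c ^ 2) / 2 := ⟨_, rfl⟩
    have hx0 : 0 < x := by linarith
    have hx1 : 0 < 1 - x := by linarith
    have hk := key hx0 (by linarith)
    rw [neg_mul, Real.exp_neg, ← div_eq_mul_inv, one_le_div (Real.exp_pos _)] at hk
    have he := Real.add_one_le_exp (a * Real.log (1 - x))
    have hl := mul_le_mul_of_nonneg_left (Real.one_sub_inv_le_log_of_pos hx1) ha.le
    have hi : (1 - x) * (1 - x)⁻¹ = 1 := mul_inv_cancel₀ hx1.ne'
    have hle : c ^ 2 * x ≤ a * ((1 - x)⁻¹ - 1) := by linarith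
    have hle' : c ^ 2 * (1 - x) * x ≤ a * x := by
      calc c ^ 2 * (1 - x) * x = c ^ 2 * x * (1 - x) := by ring
        _ ≤ a * ((1 - x)⁻¹ - 1) * (1 - x) := mul_le_mul_of_nonneg_right hle hx1.le
        _ = a * x := by linear_combination a * hi
    have := le_of_mul_le_mul_right hle' hx0
    have hcx : c ^ 2 * x = (c ^ 2 - a) / 2 := by
      rw [hx]
      linear_combination -hmul / 2
    linarith
end

section
/- Let 𝔅 be a commutative unital complex Banach algebra, let d ∈ ℕ, let a = (a_1, …, a_d) ∈ 𝔅^d, and let B ⊆ ℂ^d be an open Euclidean ball (of some center and radius) containing the joint spectrum σ_𝔅(a). Then there exists a unique unital ℂ-algebra homomorphism Φ from the algebra O(B) of holomorphic functions on B to 𝔅 such that (i) Φ(p|_B) = p(a) for every polynomial p ∈ ℂ[z_1, …, z_d], and (ii) Φ is continuous with respect to the topology of uniform convergence on compact subsets of B; in particular, whenever a sequence (f_k) in O(B) converges to f ∈ O(B) uniformly on every compact subset of B, then Φ(f_k) → Φ(f) in the norm of 𝔅. -/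
open Metric

/-- The joint spectrum of a tuple `a ∈ 𝔅^d` in a commutative unital Banach algebra `𝔅`:
the set of `(χ(a₁), …, χ(a_d))` where `χ` ranges over the characters of `𝔅`. -/
def jointSpectrum {B : Type*} [NormedCommRing B] [NormedAlgebra ℂ B] {d : ℕ}
    (a : Fin d → B) : Set (EuclideanSpace ℂ (Fin d)) :=
  {z | ∃ χ : B →ₐ[ℂ] ℂ, ∀ i, χ (a i) = z i}

/-- The algebra `O(B)` of functions on `ℂ^d` that are holomorphic on the open ball with
center `c` and radius `r` (only the restriction to the ball is relevant). -/
def HolBall (d : ℕ) (c : EuclideanSpace ℂ (Fin d)) (r : ℝ) :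
    Subalgebra ℂ (EuclideanSpace ℂ (Fin d) → ℂ) where
  carrier := {f | DifferentiableOn ℂ f (ball c r)}
  mul_mem' hf hg := hf.mul hg
  add_mem' hf hg := hf.add hg
  algebraMap_mem' _ := differentiableOn_const _

/-- A map `Φ : O(B) → 𝔅` is continuous with respect to the topology of uniform convergence
on compact subsets of the ball `B` if `Φ(f_k) → Φ(f)` whenever `f_k → f` uniformly on every
compact subset of `B`. -/
def SeqContinuousOnCompacts {B : Type*} [NormedCommRing B] [NormedAlgebra ℂ B]
    {d : ℕ} {c : EuclideanSpace ℂ (Fin d)} {r : ℝ} (Φ : HolBall d c r →ₐ[ℂ] B) : Prop :=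
  ∀ (F : ℕ → HolBall d c r) (f : HolBall d c r),
    (∀ K : Set (EuclideanSpace ℂ (Fin d)), IsCompact K → K ⊆ ball c r →
      TendstoUniformlyOn (fun k z => (F k : EuclideanSpace ℂ (Fin d) → ℂ) z)
        (f : EuclideanSpace ℂ (Fin d) → ℂ) Filter.atTop K) →
    Filter.Tendsto (fun k => Φ (F k)) Filter.atTop (nhds (Φ f))

/-- `Φ : O(B) → 𝔅` extends the polynomial functional calculus of the tuple `a ∈ 𝔅^d`. -/
def ExtendsPolynomialCalculus {B : Type*} [NormedCommRing B] [NormedAlgebra ℂ B]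
    {d : ℕ} {c : EuclideanSpace ℂ (Fin d)} {r : ℝ} (Φ : HolBall d c r →ₐ[ℂ] B)
    (a : Fin d → B) : Prop :=
  ∀ (p : MvPolynomial (Fin d) ℂ)
    (hp : (fun z : EuclideanSpace ℂ (Fin d) =>
      MvPolynomial.eval (fun i => z i) p) ∈ HolBall d c r),
    Φ ⟨_, hp⟩ = MvPolynomial.aeval a p

open Filter Topology

/-- If every element of a compact set `K` has spectral radius less than `r`, then the powers of
the elements of `K` grow uniformly slower than `r ^ n`. -/
lemma IsCompact.exists_norm_pow_le_of_spectralRadius_lt {A : Type*} [NormedRing A]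
    [NormedAlgebra ℂ A] [CompleteSpace A] {K : Set A} (hK : IsCompact K) {r : ℝ} (hr : 0 < r)
    (h : ∀ x ∈ K, spectralRadius ℂ x < ENNReal.ofReal r) :
    ∃ s, 0 < s ∧ s < r ∧ ∃ C, 0 ≤ C ∧ ∀ x ∈ K, ∀ n : ℕ, ‖x ^ n‖ ≤ C * s ^ n := by
  refine hK.induction_on (p := fun K => ∃ s, 0 < s ∧ s < r ∧ ∃ C, 0 ≤ C ∧
    ∀ x ∈ K, ∀ n : ℕ, ‖x ^ n‖ ≤ C * s ^ n) ?_ ?_ ?_ ?_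
  · exact ⟨r / 2, by positivity, by linarith, 0, le_rfl, by simp⟩
  · rintro S T hST ⟨s, hs, hsr, C, hC, H⟩
    exact ⟨s, hs, hsr, C, hC, fun x hx => H x (hST hx)⟩
  · rintro S T ⟨s, hs, hsr, C, hC, H⟩ ⟨s', hs', hsr', C', hC', H'⟩
    refine ⟨max s s', lt_max_of_lt_left hs, max_lt hsr hsr', max C C', le_max_of_le_left hC, ?_⟩
    rintro x (hx | hx) n
    · refine (H x hx n).trans ?_
      gcongr
      exacts [le_max_left _ _, le_max_left _ _]
    · refine (H' x hx n).trans ?_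
      gcongr
      exacts [le_max_right _ _, le_max_right _ _]
  · intro x hx
    obtain ⟨s, hxs, hsr⟩ := ENNReal.lt_iff_exists_nnreal_btwn.1 (h x hx)
    have hs : (0 : ℝ) < s := by
      have : (0 : ENNReal) < s := lt_of_le_of_lt zero_le hxs
      exact_mod_cast this
    have hsr : (s : ℝ) < r := by
      rw [← ENNReal.ofReal_coe_nnreal] at hsr
      exact (ENNReal.ofReal_lt_ofReal_iff hr).1 hsr
    obtain ⟨N, hN, hN0⟩ := (((spectrum.pow_norm_pow_one_div_tendsto_nhds_spectralRadius
      x).eventually_lt_const hxs).and (eventually_gt_atTop 0)).exists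
    have hxN : ‖x ^ N‖ < (s : ℝ) ^ N := by
      rw [← ENNReal.ofReal_coe_nnreal, ENNReal.ofReal_lt_ofReal_iff hs] at hN
      calc ‖x ^ N‖ = (‖x ^ N‖ ^ (1 / (N : ℝ))) ^ N := by
            rw [one_div, Real.rpow_inv_natCast_pow (norm_nonneg _) hN0.ne']
        _ < (s : ℝ) ^ N := by gcongr
    have hU : ∀ᶠ y in 𝓝 x, ‖y ^ N‖ < (s : ℝ) ^ N ∧
        ∀ j ∈ Finset.range N, ‖y ^ j‖ < ‖x ^ j‖ + 1 := by
      refine ((continuous_pow N).norm.continuousAt.eventually_lt_const hxN).and ?_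
      rw [eventually_all_finset]
      exact fun j _ => (continuous_pow j).norm.continuousAt.eventually_lt_const (lt_add_one _)
    refine ⟨_, mem_nhdsWithin_of_mem_nhds hU, s, hs, hsr,
      ∑ j ∈ Finset.range N, (‖x ^ j‖ + 1) / (s : ℝ) ^ j, by positivity, ?_⟩
    rintro y ⟨hyN, hyj⟩ n
    induction n using Nat.strong_induction_on with
    | _ n ih =>
      rcases lt_or_ge n N with hn | hn
      · rw [← div_le_iff₀ (by positivity)]
        calc ‖y ^ n‖ / (s : ℝ) ^ n ≤ (‖x ^ n‖ + 1) / (s : ℝ) ^ n := by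
              gcongr
              exact (hyj n (Finset.mem_range.2 hn)).le
          _ ≤ _ := Finset.single_le_sum (f := fun j => (‖x ^ j‖ + 1) / (s : ℝ) ^ j)
              (fun j _ => by positivity) (Finset.mem_range.2 hn)
      · obtain ⟨m, rfl⟩ := Nat.exists_eq_add_of_le hn
        rw [pow_add, pow_add, mul_left_comm]
        exact (norm_mul_le _ _).trans (mul_le_mul hyN.le (ih m (by omega)) (norm_nonneg _)
          (by positivity))

/-- In a commutative Banach algebra, an element on which all characters are bounded by less
than `r` has spectral radius less than `r`. -/
lemma spectralRadius_lt_of_forall_algHom_norm_lt {A : Type*} [NormedCommRing A] [NormedAlgebra ℂ A]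
    [CompleteSpace A] {x : A} {r : ℝ} (hr : 0 < r) (h : ∀ χ : A →ₐ[ℂ] ℂ, ‖χ x‖ < r) :
    spectralRadius ℂ x < ENNReal.ofReal r := by
  cases subsingleton_or_nontrivial A
  · simpa [spectralRadius] using hr
  · refine spectrum.spectralRadius_lt_of_forall_lt x fun z hz => ?_
    obtain ⟨χ, rfl⟩ := WeakDual.CharacterSpace.mem_spectrum_iff_exists.1 hz
    rw [← NNReal.coe_lt_coe, coe_nnnorm, Real.coe_toNNReal _ hr.le]
    exact h (WeakDual.CharacterSpace.equivAlgHom χ)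

/-- If the joint spectrum of `b` lies in the ball of radius `r` around `0`, then the powers of the
linear combinations `∑ i, ζ i • b i` with `ζ` in the unit ball grow uniformly slower than
`r ^ n`. -/
lemma exists_norm_linearCombination_pow_le {B : Type*} [NormedCommRing B] [NormedAlgebra ℂ B]
    [CompleteSpace B] {d : ℕ} (b : Fin d → B) {r : ℝ} (hr : 0 < r)
    (hb : jointSpectrum b ⊆ ball 0 r) :
    ∃ s, 0 < s ∧ s < r ∧ ∃ C, 0 ≤ C ∧ ∀ ζ : EuclideanSpace ℂ (Fin d), ‖ζ‖ ≤ 1 →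
      ∀ n : ℕ, ‖(∑ i, ζ i • b i) ^ n‖ ≤ C * s ^ n := by
  have hK : IsCompact ((fun ζ : EuclideanSpace ℂ (Fin d) => ∑ i, ζ i • b i) '' closedBall 0 1) :=
    (isCompact_closedBall 0 1).image (by fun_prop)
  obtain ⟨s, hs, hsr, C, hC, H⟩ := hK.exists_norm_pow_le_of_spectralRadius_lt hr <| by
    rintro _ ⟨ζ, hζ, rfl⟩
    refine spectralRadius_lt_of_forall_algHom_norm_lt hr fun χ => ?_
    have hχ : ‖(WithLp.toLp 2 fun i => χ (b i) : EuclideanSpace ℂ (Fin d))‖ < r := by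
      simpa using hb (⟨χ, fun i => rfl⟩ : WithLp.toLp 2 (fun i => χ (b i)) ∈ jointSpectrum b)
    have hin : χ (∑ i, ζ i • b i) =
        inner ℂ (WithLp.toLp 2 fun i => star (ζ i) : EuclideanSpace ℂ (Fin d))
          (WithLp.toLp 2 fun i => χ (b i)) := by
      simp [PiLp.inner_apply, mul_comm]
    have hstar : ‖(WithLp.toLp 2 fun i => star (ζ i) : EuclideanSpace ℂ (Fin d))‖ = ‖ζ‖ := by
      simp [EuclideanSpace.norm_eq]
    calc ‖χ (∑ i, ζ i • b i)‖ ≤ ‖ζ‖ * ‖WithLp.toLp 2 fun i => χ (b i)‖ := by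
          rw [hin, ← hstar]
          exact norm_inner_le_norm _ _
      _ ≤ 1 * ‖WithLp.toLp 2 fun i => χ (b i)‖ := by
          gcongr
          simpa using hζ
      _ < r := by simpa using hχ
  exact ⟨s, hs, hsr, C, hC, fun ζ hζ => H _ ⟨ζ, by simpa using hζ, rfl⟩⟩

/-- **Cauchy's estimate** for the coefficients of a vector-valued polynomial on a torus. -/
lemma prod_pow_mul_norm_le_of_forall_norm_sum_le {V ι κ : Type*} [NormedAddCommGroup V]
    [NormedSpace ℂ V] [Fintype ι] (S : Finset κ) (e : κ → ι → ℕ)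
    (he : Set.InjOn e S) (v : κ → V) {R : ι → ℝ} (hR : ∀ i, 0 ≤ R i) {M : ℝ}
    (h : ∀ z : ι → ℂ, (∀ i, ‖z i‖ = R i) → ‖∑ k ∈ S, (∏ i, z i ^ e k i) • v k‖ ≤ M)
    {α : κ} (hα : α ∈ S) : (∏ i, R i ^ e α i) * ‖v α‖ ≤ M := by
  classical
  set N : ℕ := ∑ k ∈ S, ∑ i, e k i + 1 with hN
  have heN : ∀ k ∈ S, ∀ i, e k i < N := fun k hk i => by
    have h1 : e k i ≤ ∑ i, e k i := Finset.single_le_sum (f := e k) (by simp) (Finset.mem_univ i)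
    have h2 : ∑ i, e k i ≤ ∑ k ∈ S, ∑ i, e k i :=
      Finset.single_le_sum (f := fun k => ∑ i, e k i) (by simp) hk
    omega
  have hω := Complex.isPrimitiveRoot_exp N (by omega)
  set ω := Complex.exp (2 * Real.pi * Complex.I / N)
  have hω1 : ‖ω‖ = 1 := hω.norm'_eq_one (by omega)
  have hω0 : ω ≠ 0 := hω.ne_zero (by omega)
  set T := Fintype.piFinset fun _ : ι => Finset.range N
  have hT : (T.card : ℝ) = (N : ℝ) ^ Fintype.card ι := by simp [T]
  have orth : ∀ k ∈ S, ∑ m ∈ T, (∏ i, (ω⁻¹ ^ e α i) ^ m i) * ∏ i, (R i * ω ^ m i : ℂ) ^ e k i =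
      if k = α then (N : ℂ) ^ Fintype.card ι * ∏ i, (R i : ℂ) ^ e α i else 0 := by
    intro k hk
    have h1 : ∀ m : ι → ℕ, (∏ i, (ω⁻¹ ^ e α i) ^ m i) * ∏ i, (R i * ω ^ m i : ℂ) ^ e k i =
        ∏ i, (R i : ℂ) ^ e k i * (ω⁻¹ ^ e α i * ω ^ e k i) ^ m i := fun m => by
      rw [← Finset.prod_mul_distrib]
      refine Finset.prod_congr rfl fun i _ => ?_
      rw [mul_pow, mul_pow, ← pow_mul ω, ← pow_mul ω, mul_comm (m i)]
      ring
    simp_rw [h1]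
    rw [← Finset.prod_univ_sum (fun _ => Finset.range N)
      (fun i j => (R i : ℂ) ^ e k i * (ω⁻¹ ^ e α i * ω ^ e k i) ^ j)]
    split_ifs with hkα
    · subst hkα
      have hone : ∀ i, ω⁻¹ ^ e k i * ω ^ e k i = 1 := fun i => by
        rw [← mul_pow, inv_mul_cancel₀ hω0, one_pow]
      simp_rw [hone]
      simp [Finset.prod_mul_distrib, mul_comm]
    · obtain ⟨i, hi⟩ : ∃ i, e k i ≠ e α i := by
        by_contra! hcon
        exact hkα (he hk hα (funext hcon))
      refine Finset.prod_eq_zero (Finset.mem_univ i) ?_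
      rw [← Finset.mul_sum]
      have hx1 : 1 - ω⁻¹ ^ e α i * ω ^ e k i ≠ 0 := fun h0 => by
        refine hi (hω.pow_inj (heN k hk i) (heN α hα i) ?_)
        rw [sub_eq_zero, inv_pow] at h0
        field_simp at h0
        exact h0.symm
      have hxN : (ω⁻¹ ^ e α i * ω ^ e k i) ^ N = 1 := by
        rw [mul_pow, ← pow_mul, ← pow_mul, mul_comm _ N, mul_comm _ N, pow_mul, pow_mul, inv_pow,
          hω.pow_eq_one]
        simp
      have := mul_neg_geom_sum (ω⁻¹ ^ e α i * ω ^ e k i) N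
      rw [hxN, sub_self] at this
      rw [(mul_eq_zero.1 this).resolve_left hx1, mul_zero]
  have key : ∑ m ∈ T, (∏ i, (ω⁻¹ ^ e α i) ^ m i) •
      ∑ k ∈ S, (∏ i, (R i * ω ^ m i : ℂ) ^ e k i) • v k =
      ((N : ℂ) ^ Fintype.card ι * ∏ i, (R i : ℂ) ^ e α i) • v α := by
    simp_rw [Finset.smul_sum, smul_smul]
    rw [Finset.sum_comm]
    simp_rw [← Finset.sum_smul]
    rw [Finset.sum_congr rfl fun k hk => by rw [orth k hk]]
    simp [ite_smul, hα]
  have hNpos : (0 : ℝ) < (N : ℝ) ^ Fintype.card ι := by positivity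
  refine le_of_mul_le_mul_left ?_ hNpos
  calc (N : ℝ) ^ Fintype.card ι * ((∏ i, R i ^ e α i) * ‖v α‖)
      = ‖((N : ℂ) ^ Fintype.card ι * ∏ i, (R i : ℂ) ^ e α i) • v α‖ := by
        rw [norm_smul, norm_mul, norm_prod, mul_assoc]
        simp [abs_of_nonneg, hR]
    _ ≤ ∑ m ∈ T, M := by
        rw [← key]
        refine norm_sum_le_of_le _ fun m _ => ?_
        rw [norm_smul, norm_prod]
        simp only [norm_pow, norm_inv, hω1, inv_one, one_pow, Finset.prod_const_one, one_mul]
        exact h _ fun i => by simp [hω1, abs_of_nonneg, hR]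
    _ = (N : ℝ) ^ Fintype.card ι * M := by rw [Finset.sum_const, nsmul_eq_mul, hT]

lemma factorial_mul_exp_le (k : ℕ) :
    (k.factorial : ℝ) * Real.exp k ≤ Real.exp 1 * (k + 1) * (k : ℝ) ^ k := by
  rcases Nat.eq_zero_or_pos k with rfl | hk
  · simp
  suffices (k.factorial : ℝ) * Real.exp k ≤ Real.exp 1 * (k : ℝ) ^ (k + 1) by
    refine this.trans ?_
    rw [pow_succ', mul_assoc]
    gcongr
    linarith
  induction k, hk using Nat.le_induction with
  | base => simp
  | succ k hk ih =>
    have hstep : Real.exp 1 * (k : ℝ) ^ (k + 1) ≤ ((k : ℝ) + 1) ^ (k + 1) := by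
      have h1 : (k : ℝ) ≤ (k + 1) * Real.exp (-1 / (k + 1)) := by
        have h2 := Real.add_one_le_exp (-1 / ((k : ℝ) + 1))
        calc (k : ℝ) = (k + 1) * (-1 / (k + 1) + 1) := by field_simp; ring
          _ ≤ _ := by gcongr
      calc Real.exp 1 * (k : ℝ) ^ (k + 1)
          ≤ Real.exp 1 * ((k + 1) * Real.exp (-1 / (k + 1))) ^ (k + 1) := by gcongr
        _ = Real.exp 1 * Real.exp (-1) * (k + 1) ^ (k + 1) := by
            rw [mul_pow, ← Real.exp_nat_mul]
            push_cast
            rw [mul_div_cancel₀ _ (by positivity)]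
            ring
        _ = _ := by rw [← Real.exp_add]; simp
    calc ((k + 1).factorial : ℝ) * Real.exp ((k + 1 : ℕ) : ℝ)
        = (k + 1) * Real.exp 1 * (k.factorial * Real.exp k) := by
          rw [Nat.factorial_succ]
          push_cast
          rw [Real.exp_add]
          ring
      _ ≤ (k + 1) * Real.exp 1 * (Real.exp 1 * (k : ℝ) ^ (k + 1)) := by gcongr
      _ ≤ (k + 1) * Real.exp 1 * ((k : ℝ) + 1) ^ (k + 1) := by gcongr
      _ = Real.exp 1 * ((k + 1 : ℕ) : ℝ) ^ (k + 1 + 1) := by push_cast; ring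

/-- Up to polynomial factors, the multinomial coefficient of `α` is the inverse of the maximum of
the monomial `x ^ α` on the standard simplex. -/
lemma one_le_multinomial_mul_prod {ι : Type*} [Fintype ι] (α : ι → ℕ) :
    1 ≤ (Nat.multinomial Finset.univ α : ℝ) *
      (∏ i, ((α i : ℝ) / (∑ j, α j : ℕ)) ^ α i) * ∏ i, (Real.exp 1 * (α i + 1)) := by
  set n := ∑ j, α j with hn
  have hfac : (0 : ℝ) < ∏ i, ((α i).factorial : ℝ) :=
    Finset.prod_pos fun i _ => by positivity
  have hnn : (0 : ℝ) < (n : ℝ) ^ n := by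
    rcases Nat.eq_zero_or_pos n with h0 | h0
    · simp [h0]
    · positivity
  have hspec : (∏ i, ((α i).factorial : ℝ)) * Nat.multinomial Finset.univ α = n.factorial := by
    exact_mod_cast Nat.multinomial_spec Finset.univ α
  have h1 : (n : ℝ) ^ n ≤ Real.exp n * n.factorial :=
    (div_le_iff₀ (by positivity)).1 (Real.pow_div_factorial_le_exp n (by positivity) n)
  have h2 : (∏ i, ((α i).factorial : ℝ)) * Real.exp n ≤
      (∏ i, (Real.exp 1 * (α i + 1))) * ∏ i, (α i : ℝ) ^ α i := by
    rw [hn]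
    push_cast
    rw [Real.exp_sum, ← Finset.prod_mul_distrib, ← Finset.prod_mul_distrib]
    exact Finset.prod_le_prod (fun i _ => by positivity) fun i _ => factorial_mul_exp_le (α i)
  have h3 : (n : ℝ) ^ n ≤ Nat.multinomial Finset.univ α *
      ((∏ i, (Real.exp 1 * (α i + 1))) * ∏ i, (α i : ℝ) ^ α i) := by
    refine le_of_mul_le_mul_left ?_ hfac
    calc (∏ i, ((α i).factorial : ℝ)) * (n : ℝ) ^ n
        ≤ (∏ i, ((α i).factorial : ℝ)) * (Real.exp n * n.factorial) := by gcongr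
      _ = ((∏ i, ((α i).factorial : ℝ)) * Real.exp n) * n.factorial := by ring
      _ ≤ ((∏ i, (Real.exp 1 * (α i + 1))) * ∏ i, (α i : ℝ) ^ α i) * n.factorial := by gcongr
      _ = _ := by rw [← hspec]; ring
  have h4 : ∏ i, ((α i : ℝ) / n) ^ α i = (∏ i, (α i : ℝ) ^ α i) / (n : ℝ) ^ n := by
    simp_rw [div_pow, Finset.prod_div_distrib]
    rw [Finset.prod_pow_eq_pow_sum]
  rw [h4]
  calc (1 : ℝ) = (n : ℝ) ^ n / (n : ℝ) ^ n := (div_self hnn.ne').symm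
    _ ≤ _ := by
      rw [div_le_iff₀ hnn]
      refine h3.trans (le_of_eq ?_)
      field_simp

/-- If the powers of the linear combinations `∑ i, ζ i • b i` with `ζ` in the Euclidean unit ball
are `O(s ^ n)`, then `p ↦ p(b)` is bounded in terms of the supremum of `p` on any Euclidean ball of
radius `t > s`. -/
lemma exists_norm_aeval_le_of_norm_linearCombination_pow_le {B : Type*} [NormedCommRing B]
    [NormedAlgebra ℂ B] {d : ℕ} (b : Fin d → B) {s t C : ℝ} (hs : 0 < s) (hst : s < t)
    (hC : 0 ≤ C) (hb : ∀ ζ : EuclideanSpace ℂ (Fin d), ‖ζ‖ ≤ 1 →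
      ∀ n : ℕ, ‖(∑ i, ζ i • b i) ^ n‖ ≤ C * s ^ n) :
    ∃ D, 0 ≤ D ∧ ∀ (p : MvPolynomial (Fin d) ℂ) (M : ℝ),
      (∀ z : EuclideanSpace ℂ (Fin d), ‖z‖ ≤ t → ‖MvPolynomial.eval (fun i => z i) p‖ ≤ M) →
      ‖MvPolynomial.aeval b p‖ ≤ D * M := by
  classical
  have ht : 0 < t := hs.trans hst
  set w : ℕ → ℝ := fun k => Real.exp 1 * (k + 1) * (s / t) ^ k with hw
  have hw0 : ∀ k, 0 ≤ w k := fun k => by positivity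
  have hwsum : Summable w := by
    have hq : ‖s / t‖ < 1 := by
      rw [Real.norm_of_nonneg (by positivity), div_lt_one ht]
      exact hst
    have h1 := summable_pow_mul_geometric_of_norm_lt_one 1 hq
    have h0 := summable_pow_mul_geometric_of_norm_lt_one 0 hq
    refine ((h1.add h0).mul_left (Real.exp 1)).congr fun k => ?_
    simp only [hw]
    ring
  refine ⟨C * (∑' k, w k) ^ d, mul_nonneg hC (pow_nonneg (tsum_nonneg hw0) _), fun p M hp => ?_⟩
  have hM : 0 ≤ M := (norm_nonneg _).trans (hp 0 (by simpa using ht.le))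
  have hcoeff : ∀ α ∈ p.support,
      ‖MvPolynomial.coeff α p • ∏ i, b i ^ α i‖ ≤ C * M * ∏ i, w (α i) := by
    intro α hα
    set n := ∑ j, α j with hn
    set R : Fin d → ℝ := fun i => √((α i : ℝ) / n) with hR
    have hR0 : ∀ i, 0 ≤ R i := fun i => Real.sqrt_nonneg _
    have hR2 : ∀ i, R i ^ 2 = (α i : ℝ) / n := fun i => Real.sq_sqrt (by positivity)
    have hRsum : ∑ i, R i ^ 2 ≤ 1 := by
      simp_rw [hR2]
      rw [← Finset.sum_div, ← Nat.cast_sum]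
      exact div_self_le_one _
    have hA : (∏ i, R i ^ α i) *
        ‖(Nat.multinomial Finset.univ α : ℂ) • ∏ i, b i ^ α i‖ ≤ C * s ^ n := by
      refine prod_pow_mul_norm_le_of_forall_norm_sum_le (Finset.piAntidiag Finset.univ n)
        (fun k => k) (fun _ _ _ _ h => h)
        (fun k => (Nat.multinomial Finset.univ k : ℂ) • ∏ i, b i ^ k i) hR0 (fun z hz => ?_)
        (α := ⇑α) (by simp [hn])
      have hz1 : ‖(WithLp.toLp 2 z : EuclideanSpace ℂ (Fin d))‖ ≤ 1 := by
        rw [EuclideanSpace.norm_eq, Real.sqrt_le_one]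
        simpa [hz] using hRsum
      refine le_of_eq_of_le (congrArg _ ?_) (hb _ hz1 n)
      rw [Finset.sum_pow_eq_sum_piAntidiag]
      refine Finset.sum_congr rfl fun k _ => ?_
      simp_rw [smul_pow, Finset.prod_smul]
      rw [smul_comm, Nat.cast_smul_eq_nsmul, nsmul_eq_mul, mul_smul_comm]
    have hB : (∏ i, (t * R i) ^ α i) * ‖MvPolynomial.coeff α p‖ ≤ M := by
      refine prod_pow_mul_norm_le_of_forall_norm_sum_le p.support (fun k i => k i)
        (fun _ _ _ _ h => DFunLike.coe_injective h) (fun k => MvPolynomial.coeff k p)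
        (fun i => mul_nonneg ht.le (hR0 i)) (fun z hz => ?_) hα
      have hz1 : ‖(WithLp.toLp 2 z : EuclideanSpace ℂ (Fin d))‖ ≤ t := by
        rw [EuclideanSpace.norm_eq, Real.sqrt_le_left ht.le]
        simp only [hz, mul_pow]
        rw [← Finset.mul_sum]
        exact mul_le_of_le_one_right (by positivity) hRsum
      refine le_of_eq_of_le (congrArg _ ?_) (hp _ hz1)
      rw [MvPolynomial.eval_eq']
      exact Finset.sum_congr rfl fun k _ => mul_comm _ _
    have hmul : ((∏ i, R i ^ α i) * (Nat.multinomial Finset.univ α * ‖∏ i, b i ^ α i‖)) *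
        ((t ^ n * ∏ i, R i ^ α i) * ‖MvPolynomial.coeff α p‖) ≤ C * s ^ n * M := by
      refine mul_le_mul ?_ ?_ (by positivity) (by positivity)
      · simpa [norm_smul] using hA
      · simpa [mul_pow, Finset.prod_mul_distrib, Finset.prod_pow_eq_pow_sum, hn] using hB
    have hRR : (∏ i, R i ^ α i) * ∏ i, R i ^ α i = ∏ i, ((α i : ℝ) / n) ^ α i := by
      rw [← Finset.prod_mul_distrib]
      refine Finset.prod_congr rfl fun i _ => ?_
      rw [← hR2, ← mul_pow, sq]
    have hone := one_le_multinomial_mul_prod α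
    rw [← hn, ← hRR] at hone
    have hwprod : ∏ i, w (α i) = (∏ i, (Real.exp 1 * (α i + 1))) * (s ^ n / t ^ n) := by
      simp only [hw]
      rw [Finset.prod_mul_distrib, Finset.prod_pow_eq_pow_sum, div_pow]
    set P := ∏ i, R i ^ α i
    set L := (Nat.multinomial Finset.univ α : ℝ)
    set Q := ∏ i, (Real.exp 1 * ((α i : ℝ) + 1))
    have hQ : 0 ≤ Q := Finset.prod_nonneg fun i _ => by positivity
    rw [norm_smul, hwprod]
    set X := ‖MvPolynomial.coeff α p‖ * ‖∏ i, b i ^ α i‖ with hX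
    have hX0 : 0 ≤ X := by positivity
    calc X ≤ L * (P * P) * Q * X := le_mul_of_one_le_left hX0 hone
      _ = (P * (L * ‖∏ i, b i ^ α i‖)) * ((t ^ n * P) * ‖MvPolynomial.coeff α p‖) * Q / t ^ n := by
          rw [hX]
          field_simp
      _ ≤ (C * s ^ n * M) * Q / t ^ n := by gcongr
      _ = _ := by ring
  set N : ℕ := ∑ k ∈ p.support, ∑ i, k i + 1 with hN
  have hsub : p.support.image (fun α i => α i) ⊆
      Fintype.piFinset fun _ : Fin d => Finset.range N := by
    intro k hk
    obtain ⟨α, hα, rfl⟩ := Finset.mem_image.1 hk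
    rw [Fintype.mem_piFinset]
    intro i
    have h1 : α i ≤ ∑ i, α i := Finset.single_le_sum (f := α) (by simp) (Finset.mem_univ i)
    have h2 : ∑ i, α i ≤ ∑ k ∈ p.support, ∑ i, k i :=
      Finset.single_le_sum (f := fun k : Fin d →₀ ℕ => ∑ i, k i) (by simp) hα
    rw [Finset.mem_range]
    omega
  calc ‖MvPolynomial.aeval b p‖ = ‖∑ α ∈ p.support, MvPolynomial.coeff α p • ∏ i, b i ^ α i‖ := by
        rw [MvPolynomial.aeval_def, MvPolynomial.eval₂_eq']
        simp_rw [Algebra.smul_def]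
    _ ≤ ∑ α ∈ p.support, C * M * ∏ i, w (α i) := norm_sum_le_of_le _ hcoeff
    _ = C * M * ∑ k ∈ p.support.image (fun (α : Fin d →₀ ℕ) i => α i), ∏ i, w (k i) := by
        rw [← Finset.mul_sum, Finset.sum_image fun _ _ _ _ h => DFunLike.coe_injective h]
    _ ≤ C * M * ∑ k ∈ Fintype.piFinset fun _ : Fin d => Finset.range N, ∏ i, w (k i) := by
        refine mul_le_mul_of_nonneg_left ?_ (by positivity)
        exact Finset.sum_le_sum_of_subset_of_nonneg hsub
          fun k _ _ => Finset.prod_nonneg fun i _ => hw0 _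
    _ = C * M * (∑ k ∈ Finset.range N, w k) ^ d := by
        rw [← Finset.prod_univ_sum]
        simp
    _ ≤ C * M * (∑' k, w k) ^ d := by
        refine mul_le_mul_of_nonneg_left ?_ (by positivity)
        exact pow_le_pow_left₀ (Finset.sum_nonneg fun k _ => hw0 k)
          (hwsum.sum_le_tsum _ fun k _ => hw0 k) d
    _ = _ := by ring

/-- If the joint spectrum of `a` lies in a Euclidean ball, then `p ↦ p(a)` is bounded in terms of
the supremum of `p` on a smaller concentric closed ball. -/
lemma exists_norm_aeval_le_of_jointSpectrum_subset {B : Type*} [NormedCommRing B]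
    [NormedAlgebra ℂ B] [CompleteSpace B] {d : ℕ} (a : Fin d → B) (c : EuclideanSpace ℂ (Fin d))
    {r : ℝ} (hr : 0 < r) (hspec : jointSpectrum a ⊆ ball c r) :
    ∃ t, 0 < t ∧ t < r ∧ ∃ D, 0 ≤ D ∧ ∀ (p : MvPolynomial (Fin d) ℂ) (M : ℝ),
      (∀ z ∈ closedBall c t, ‖MvPolynomial.eval (fun i => z i) p‖ ≤ M) →
      ‖MvPolynomial.aeval a p‖ ≤ D * M := by
  set b : Fin d → B := fun i => a i - algebraMap ℂ B (c i) with hb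
  have hbspec : jointSpectrum b ⊆ ball 0 r := by
    rintro z ⟨χ, hχ⟩
    have hz : z + c ∈ ball c r := hspec ⟨χ, fun i => by
      have := hχ i
      simp only [hb, map_sub, AlgHom.commutes, Algebra.algebraMap_self, RingHom.id_apply] at this
      simp [← this]⟩
    simpa [dist_eq_norm] using hz
  obtain ⟨s, hs, hsr, C, hC, H⟩ := exists_norm_linearCombination_pow_le b hr hbspec
  obtain ⟨t, hst, htr⟩ := exists_between hsr
  obtain ⟨D, hD, hDp⟩ := exists_norm_aeval_le_of_norm_linearCombination_pow_le b hs hst hC H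
  refine ⟨t, hs.trans hst, htr, D, hD, fun p M hp => ?_⟩
  set q : MvPolynomial (Fin d) ℂ :=
    MvPolynomial.aeval (fun i => MvPolynomial.X i + MvPolynomial.C (c i)) p with hq
  have hqa : MvPolynomial.aeval b q = MvPolynomial.aeval a p := by
    rw [hq, MvPolynomial.aeval_eq_bind₁, MvPolynomial.aeval_bind₁]
    congr 2
    funext i
    simp [hb]
  rw [← hqa]
  refine hDp q M fun z hz => ?_
  have hqz : MvPolynomial.eval (fun i => z i) q = MvPolynomial.eval (fun i => (z + c) i) p := by
    rw [hq, MvPolynomial.aeval_eq_bind₁, ← MvPolynomial.coe_aeval_eq_eval,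
      ← MvPolynomial.coe_aeval_eq_eval]
    change MvPolynomial.aeval _ _ = MvPolynomial.aeval _ _
    rw [MvPolynomial.aeval_bind₁]
    congr 2
    funext i
    simp
  rw [hqz]
  exact hp _ (by simpa [dist_eq_norm] using hz)

/-- An entire function of polynomial growth is a polynomial. -/
lemma Differentiable.exists_polynomial_of_norm_le {g : ℂ → ℂ} (hg : Differentiable ℂ g) {A : ℝ}
    {n : ℕ} (hA : ∀ z, ‖g z‖ ≤ A * (1 + ‖z‖) ^ n) :
    ∃ q : Polynomial ℂ, q.degree < (n + 1 : ℕ) ∧ ∀ z, g z = q.eval z := by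
  have hA0 : 0 ≤ A := by simpa using (norm_nonneg _).trans (hA 0)
  have hvanish : ∀ m, n + 1 ≤ m → iteratedDeriv m g 0 = 0 := by
    intro m hm
    have hbound : ∀ᶠ R : ℝ in atTop,
        ‖iteratedDeriv m g 0‖ ≤ (m.factorial * (A * 2 ^ n)) / R := by
      filter_upwards [eventually_ge_atTop 1] with R hR
      have hR0 : 0 < R := by linarith
      refine (Complex.norm_iteratedDeriv_le_of_forall_mem_sphere_norm_le m hR0
        hg.diffContOnCl (C := A * (1 + R) ^ n) fun z hz => ?_).trans ?_
      · simpa [mem_sphere_zero_iff_norm.1 hz] using hA z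
      · rw [div_le_div_iff₀ (by positivity) hR0]
        calc m.factorial * (A * (1 + R) ^ n) * R ≤ m.factorial * (A * (2 * R) ^ n) * R := by
              gcongr
              linarith
          _ = m.factorial * (A * 2 ^ n) * R ^ (n + 1) := by ring
          _ ≤ m.factorial * (A * 2 ^ n) * R ^ m := by gcongr
    have hlim : Tendsto (fun R : ℝ => (m.factorial * (A * 2 ^ n)) / R) atTop (𝓝 0) :=
      tendsto_const_nhds.div_atTop tendsto_id
    exact norm_le_zero_iff.1 (ge_of_tendsto hlim hbound)
  refine ⟨∑ m ∈ Finset.range (n + 1),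
    Polynomial.C ((m.factorial : ℂ)⁻¹ * iteratedDeriv m g 0) * Polynomial.X ^ m, ?_, fun z => ?_⟩
  · rw [← Polynomial.mem_degreeLT]
    refine Submodule.sum_mem _ fun m hm => Polynomial.mem_degreeLT.2 ?_
    exact (Polynomial.degree_C_mul_X_pow_le _ _).trans_lt (by exact_mod_cast Finset.mem_range.1 hm)
  · rw [Polynomial.eval_finsetSum]
    refine ((Complex.hasSum_taylorSeries_of_entire hg 0 z).unique
      (hasSum_sum_of_ne_finset_zero (s := Finset.range (n + 1)) fun m hm => ?_)).trans
      (Finset.sum_congr rfl fun m _ => ?_)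
    · simp [hvanish m (by simpa using hm)]
    · simp
      ring

/-- A function of several variables which is a polynomial of bounded degree in each variable
separately is a polynomial. -/
lemma exists_mvPolynomial_of_forall_update {K : Type*} [Field K] [CharZero K] (n : ℕ) {d : ℕ}
    (g : (Fin d → K) → K)
    (h : ∀ z i, ∃ q : Polynomial K, q.degree < (n + 1 : ℕ) ∧
      ∀ x, g (Function.update z i x) = q.eval x) :
    ∃ P : MvPolynomial (Fin d) K, ∀ z, g z = MvPolynomial.eval z P := by
  induction d with
  | zero => exact ⟨MvPolynomial.C (g 0), fun z => by simp [Subsingleton.elim z 0]⟩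
  | succ d ih =>
    have hslice : ∀ j : ℕ, ∃ P : MvPolynomial (Fin d) K,
        ∀ y, g (Fin.cons (j : K) y) = MvPolynomial.eval y P := fun j =>
      ih (fun y => g (Fin.cons (j : K) y)) fun y i => by
        obtain ⟨q, hq, hgq⟩ := h (Fin.cons (j : K) y) i.succ
        exact ⟨q, hq, fun x => by rw [← hgq, Fin.cons_update]⟩
    choose P hP using hslice
    refine ⟨∑ j ∈ Finset.range (n + 1),
      Polynomial.aeval (MvPolynomial.X 0)
        (Lagrange.basis (Finset.range (n + 1)) (fun j : ℕ => (j : K)) j) *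
      MvPolynomial.rename Fin.succ (P j), fun z => ?_⟩
    obtain ⟨q, hq, hgq⟩ := h z 0
    have hval : ∀ x, g (Fin.cons x (Fin.tail z)) = q.eval x := fun x => by
      rw [← hgq, ← Fin.update_cons_zero (z 0), Fin.cons_self_tail]
    have hinterp := Lagrange.eq_interpolate_of_eval_eq (s := Finset.range (n + 1))
      (v := fun j : ℕ => (j : K)) (fun j : ℕ => g (Fin.cons (j : K) (Fin.tail z)))
      Nat.cast_injective.injOn (by simpa using hq) fun j _ => (hval j).symm
    calc g z = q.eval (z 0) := by rw [← hval, Fin.cons_self_tail]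
      _ = _ := by
        rw [hinterp, Lagrange.interpolate_apply, Polynomial.eval_finsetSum, map_sum]
        refine Finset.sum_congr rfl fun j _ => ?_
        have h1 : ∀ p : Polynomial K, MvPolynomial.eval z
            (Polynomial.aeval (MvPolynomial.X 0) p) = p.eval (z 0) := fun p => by
          rw [← MvPolynomial.coe_aeval_eq_eval]
          change MvPolynomial.aeval z _ = _
          rw [← Polynomial.aeval_algHom_apply, MvPolynomial.aeval_X, Polynomial.coe_aeval_eq_eval]
        rw [map_mul, h1, MvPolynomial.eval_rename, Polynomial.eval_mul, Polynomial.eval_C, hP,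
          mul_comm]
        rfl

section HomogeneousPart

variable {E : Type*} [NormedAddCommGroup E] [NormedSpace ℂ E]

/-- The homogeneous part of degree `n` of the Taylor expansion of `f` at the origin. -/
noncomputable def homogeneousPart (f : E → ℂ) (n : ℕ) (z : E) : ℂ :=
  (n.factorial : ℂ)⁻¹ * iteratedDeriv n (fun μ : ℂ => f (μ • z)) 0

variable {f : E → ℂ} {r t M : ℝ}

lemma differentiableOn_comp_smul (hf : DifferentiableOn ℂ f (ball 0 r)) (htr : t < r) {z : E}
    {R : ℝ} (hRz : R * ‖z‖ ≤ t) :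
    DifferentiableOn ℂ (fun μ : ℂ => f (μ • z)) (closedBall 0 R) := by
  refine hf.comp (by fun_prop) fun μ hμ => ?_
  rw [mem_ball_zero_iff, norm_smul]
  rw [mem_closedBall_zero_iff] at hμ
  exact ((mul_le_mul_of_nonneg_right hμ (norm_nonneg z)).trans hRz).trans_lt htr

lemma norm_homogeneousPart_le (hf : DifferentiableOn ℂ f (ball 0 r)) (htr : t < r)
    (hM : ∀ z ∈ closedBall (0 : E) t, ‖f z‖ ≤ M) {z : E} {R : ℝ} (hR : 0 < R)
    (hRz : R * ‖z‖ ≤ t) (n : ℕ) : ‖homogeneousPart f n z‖ ≤ M / R ^ n := by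
  have h := Complex.norm_iteratedDeriv_le_of_forall_mem_sphere_norm_le n hR
    (f := fun μ : ℂ => f (μ • z)) (c := 0) (C := M)
    (DifferentiableOn.diffContOnCl <| (differentiableOn_comp_smul hf htr hRz).mono
      closure_ball_subset_closedBall) fun μ hμ => hM _ <| by
        rw [mem_closedBall_zero_iff, norm_smul, mem_sphere_zero_iff_norm.1 hμ]
        exact hRz
  rw [homogeneousPart, norm_mul, norm_inv, Complex.norm_natCast, inv_mul_le_iff₀ (by positivity)]
  exact h.trans_eq (mul_div_assoc _ _ _)

lemma norm_sub_sum_homogeneousPart_le (hf : DifferentiableOn ℂ f (ball 0 r)) (htr : t < r)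
    (hM : ∀ z ∈ closedBall (0 : E) t, ‖f z‖ ≤ M) {z : E} {R : ℝ} (hR : 0 < R)
    (hRz : R * ‖z‖ ≤ t) {q : ℝ} (hq : q < 1) {μ : ℂ} (hμ : ‖μ‖ ≤ q * R) (N : ℕ) :
    ‖f (μ • z) - ∑ n ∈ Finset.range N, μ ^ n * homogeneousPart f n z‖ ≤ M * q ^ N / (1 - q) := by
  have hq0 : 0 ≤ q := nonneg_of_mul_nonneg_left ((norm_nonneg μ).trans hμ) hR
  have hM0 : 0 ≤ M := (norm_nonneg _).trans (hM 0 (by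
    simpa using (mul_nonneg hR.le (norm_nonneg z)).trans hRz))
  have hsum : HasSum (fun n => μ ^ n * homogeneousPart f n z) (f (μ • z)) := by
    have hμR : μ ∈ ball (0 : ℂ) R := by
      rw [mem_ball_zero_iff]
      nlinarith
    have := Complex.hasSum_taylorSeries_on_ball
      ((differentiableOn_comp_smul hf htr hRz).mono ball_subset_closedBall) hμR
    refine this.congr_fun fun n => ?_
    simp only [homogeneousPart, smul_eq_mul, sub_zero]
    ring
  have hgeom : HasSum (fun n => M * q ^ N * q ^ n) (M * q ^ N * (1 - q)⁻¹) :=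
    (hasSum_geometric_of_lt_one hq0 hq).mul_left _
  rw [div_eq_mul_inv]
  refine ((hasSum_nat_add_iff' N).2 hsum).norm_le_of_bounded hgeom fun n => ?_
  have hR' : (0 : ℝ) < R ^ (n + N) := by positivity
  calc ‖μ ^ (n + N) * homogeneousPart f (n + N) z‖ ≤ (q * R) ^ (n + N) * (M / R ^ (n + N)) := by
        rw [norm_mul, norm_pow]
        gcongr
        exact norm_homogeneousPart_le hf htr hM hR hRz _
    _ = M * q ^ N * q ^ n := by
        rw [mul_pow]
        field_simp
        ring

lemma differentiable_homogeneousPart_add_smul (hf : DifferentiableOn ℂ f (ball 0 r)) (ht : 0 < t)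
    (htr : t < r) (hM : ∀ z ∈ closedBall (0 : E) t, ‖f z‖ ≤ M) (n : ℕ) (z v : E) :
    Differentiable ℂ fun x : ℂ => homogeneousPart f n (z + x • v) := by
  have hM0 : 0 ≤ M := (norm_nonneg _).trans (hM 0 (by simpa using ht.le))
  induction n using Nat.strong_induction_on with
  | _ n ih =>
    suffices ∀ ρ > 0, DifferentiableOn ℂ (fun x : ℂ => homogeneousPart f n (z + x • v))
        (ball 0 ρ) by
      intro x
      exact (this (‖x‖ + 1) (by positivity)).differentiableAt
        (isOpen_ball.mem_nhds (by simp))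
    intro ρ hρ
    set K := ‖z‖ + ρ * ‖v‖ + 1 with hK
    have hK0 : 0 < K := by positivity
    set R := t / K with hR
    have hR0 : 0 < R := by positivity
    have hw : ∀ x ∈ ball (0 : ℂ) ρ, R * ‖z + x • v‖ ≤ t := fun x hx => by
      have : ‖z + x • v‖ ≤ K := by
        refine (norm_add_le _ _).trans ?_
        rw [norm_smul]
        have := mul_le_mul_of_nonneg_right (mem_ball_zero_iff.1 hx).le (norm_nonneg v)
        linarith
      calc R * ‖z + x • v‖ ≤ R * K := by gcongr
        _ = t := by rw [hR]; field_simp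
    have hsmall : ∀ᶠ μ : ℂ in 𝓝[≠] 0, ‖μ‖ < R / 2 ∧ μ ≠ 0 :=
      (eventually_nhdsWithin_of_eventually_nhds
        (continuous_norm.continuousAt.eventually_lt_const (by simpa using hR0))).and
        eventually_mem_nhdsWithin
    refine TendstoLocallyUniformlyOn.differentiableOn (φ := 𝓝[≠] (0 : ℂ))
      (F := fun μ x => (f (μ • (z + x • v)) -
        ∑ m ∈ Finset.range n, μ ^ m * homogeneousPart f m (z + x • v)) / μ ^ n)
      (TendstoUniformlyOn.tendstoLocallyUniformlyOn ?_) ?_ isOpen_ball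
    · rw [Metric.tendstoUniformlyOn_iff]
      intro ε hε
      have hlim : Tendsto (fun μ : ℂ => 2 * M / R ^ (n + 1) * ‖μ‖) (𝓝[≠] 0) (𝓝 0) := by
        have : Tendsto (fun μ : ℂ => 2 * M / R ^ (n + 1) * ‖μ‖) (𝓝 0)
            (𝓝 (2 * M / R ^ (n + 1) * ‖(0 : ℂ)‖)) := Continuous.tendsto (by fun_prop) 0
        simp only [norm_zero, mul_zero] at this
        exact this.mono_left nhdsWithin_le_nhds
      filter_upwards [hsmall, hlim.eventually_lt_const hε] with μ ⟨hμ, hμ0⟩ hμε x hx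
      refine lt_of_le_of_lt ?_ hμε
      have hμ0' : 0 < ‖μ‖ := norm_pos_iff.2 hμ0
      have hq : ‖μ‖ / R ≤ 1 / 2 := by
        rw [div_le_iff₀ hR0]
        linarith
      have hrem := norm_sub_sum_homogeneousPart_le hf htr hM hR0 (hw x hx) (q := ‖μ‖ / R)
        (by linarith) (div_mul_cancel₀ _ hR0.ne').ge (n + 1)
      rw [Finset.sum_range_succ, ← sub_sub] at hrem
      rw [dist_comm, dist_eq_norm, div_sub' (pow_ne_zero n hμ0), norm_div, norm_pow,
        div_le_iff₀ (by positivity)]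
      refine hrem.trans ?_
      calc M * (‖μ‖ / R) ^ (n + 1) / (1 - ‖μ‖ / R)
          ≤ M * (‖μ‖ / R) ^ (n + 1) / (1 / 2) := by
            gcongr
            linarith
        _ = 2 * M / R ^ (n + 1) * ‖μ‖ * ‖μ‖ ^ n := by
            rw [div_pow]
            field_simp
            ring
    · filter_upwards [hsmall] with μ ⟨hμ, hμ0⟩
      refine DifferentiableOn.div_const (DifferentiableOn.sub ?_ ?_) _
      · refine hf.comp (by fun_prop) fun x hx => ?_
        rw [mem_ball_zero_iff, norm_smul]
        refine lt_of_le_of_lt ?_ htr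
        refine (mul_le_mul_of_nonneg_right ?_ (norm_nonneg _)).trans (hw x hx)
        linarith
      · refine DifferentiableOn.fun_sum fun m hm => ?_
        exact ((ih m (Finset.mem_range.1 hm)).const_mul _).differentiableOn

lemma exists_polynomial_homogeneousPart_add_smul (hf : DifferentiableOn ℂ f (ball 0 r))
    (ht : 0 < t) (htr : t < r) (hM : ∀ z ∈ closedBall (0 : E) t, ‖f z‖ ≤ M) (n : ℕ) (z v : E) :
    ∃ q : Polynomial ℂ, q.degree < (n + 1 : ℕ) ∧
      ∀ x : ℂ, homogeneousPart f n (z + x • v) = q.eval x := by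
  have hM0 : 0 ≤ M := (norm_nonneg _).trans (hM 0 (by simpa using ht.le))
  refine (differentiable_homogeneousPart_add_smul hf ht htr hM n z v).exists_polynomial_of_norm_le
    (A := M * ((‖z‖ + ‖v‖ + 1) / t) ^ n) fun x => ?_
  set K := ‖z + x • v‖ + 1 with hK
  have hK0 : 0 < K := by positivity
  have hKle : K ≤ (‖z‖ + ‖v‖ + 1) * (1 + ‖x‖) := by
    have := norm_add_le z (x • v)
    rw [norm_smul] at this
    nlinarith [norm_nonneg z, norm_nonneg v, norm_nonneg x,
      mul_nonneg (norm_nonneg z) (norm_nonneg x)]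
  calc ‖homogeneousPart f n (z + x • v)‖ ≤ M / (t / K) ^ n := by
        refine norm_homogeneousPart_le hf htr hM (by positivity) ?_ n
        rw [div_mul_eq_mul_div, div_le_iff₀ hK0]
        gcongr
        linarith
    _ = M * (K / t) ^ n := by rw [div_eq_mul_inv, ← inv_pow, inv_div]
    _ ≤ M * ((‖z‖ + ‖v‖ + 1) * (1 + ‖x‖) / t) ^ n := by gcongr
    _ = _ := by rw [mul_div_right_comm, mul_pow, mul_assoc]

end HomogeneousPart

lemma exists_mvPolynomial_homogeneousPart {d : ℕ} {f : EuclideanSpace ℂ (Fin d) → ℂ} {r t M : ℝ}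
    (hf : DifferentiableOn ℂ f (ball 0 r)) (ht : 0 < t) (htr : t < r)
    (hM : ∀ z ∈ closedBall (0 : EuclideanSpace ℂ (Fin d)) t, ‖f z‖ ≤ M) (n : ℕ) :
    ∃ P : MvPolynomial (Fin d) ℂ, ∀ z : EuclideanSpace ℂ (Fin d),
      homogeneousPart f n z = MvPolynomial.eval (fun i => z i) P := by
  obtain ⟨P, hP⟩ := exists_mvPolynomial_of_forall_update n
    (fun z : Fin d → ℂ => homogeneousPart f n (WithLp.toLp 2 z)) fun z i => by
      obtain ⟨q, hq, h⟩ := exists_polynomial_homogeneousPart_add_smul hf ht htr hM n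
        (WithLp.toLp 2 (Function.update z i 0)) (EuclideanSpace.single i 1)
      refine ⟨q, hq, fun x => ?_⟩
      rw [← h]
      congr 1
      ext j
      rcases eq_or_ne j i with rfl | hj
      · simp
      · simp [hj]
  exact ⟨P, fun z => hP fun i => z i⟩

/-- A holomorphic function on a ball is a uniform limit of polynomials on every smaller concentric
closed ball. -/
lemma exists_mvPolynomial_norm_sub_le {d : ℕ} {f : EuclideanSpace ℂ (Fin d) → ℂ}
    {c : EuclideanSpace ℂ (Fin d)} {r : ℝ} (hr : 0 < r) (hf : DifferentiableOn ℂ f (ball c r))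
    {t : ℝ} (htr : t < r) {ε : ℝ} (hε : 0 < ε) :
    ∃ P : MvPolynomial (Fin d) ℂ,
      ∀ z ∈ closedBall c t, ‖f z - MvPolynomial.eval (fun i => z i) P‖ ≤ ε := by
  obtain ⟨s, hts, hsr⟩ := exists_between (max_lt htr hr)
  obtain ⟨u, hsu, hur⟩ := exists_between hsr
  have hs : 0 < s := (le_max_right _ _).trans_lt hts
  have hu : 0 < u := hs.trans hsu
  set g : EuclideanSpace ℂ (Fin d) → ℂ := fun w => f (c + w) with hg_def
  have hg : DifferentiableOn ℂ g (ball 0 r) :=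
    hf.comp (by fun_prop) fun w hw => by simpa [dist_eq_norm] using hw
  obtain ⟨M, hM⟩ := (isCompact_closedBall (0 : EuclideanSpace ℂ (Fin d)) u).exists_bound_of_continuousOn
    (hg.continuousOn.mono (closedBall_subset_ball hur))
  choose P hP using exists_mvPolynomial_homogeneousPart hg hu hur hM
  have hlim : Tendsto (fun N : ℕ => M * (s / u) ^ N / (1 - s / u)) atTop (𝓝 0) := by
    have := ((tendsto_pow_atTop_nhds_zero_of_lt_one (by positivity : 0 ≤ s / u)
      ((div_lt_one hu).2 hsu)).const_mul M).div_const (1 - s / u)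
    simpa using this
  obtain ⟨N, hN⟩ := (hlim.eventually_lt_const hε).exists
  refine ⟨∑ n ∈ Finset.range N,
    MvPolynomial.aeval (fun i => MvPolynomial.X i - MvPolynomial.C (c i)) (P n), fun z hz => ?_⟩
  have heval : ∀ n, MvPolynomial.eval (fun i => z i)
      (MvPolynomial.aeval (fun i => MvPolynomial.X i - MvPolynomial.C (c i)) (P n)) =
      homogeneousPart g n (z - c) := fun n => by
    rw [hP, MvPolynomial.aeval_eq_bind₁, ← MvPolynomial.coe_aeval_eq_eval,
      ← MvPolynomial.coe_aeval_eq_eval]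
    change MvPolynomial.aeval _ _ = MvPolynomial.aeval _ _
    rw [MvPolynomial.aeval_bind₁]
    congr 2
    funext i
    simp
  have hzs : ‖z - c‖ ≤ s := by
    rw [← dist_eq_norm]
    exact (mem_closedBall.1 hz).trans ((le_max_left _ _).trans hts.le)
  have hrem := norm_sub_sum_homogeneousPart_le hg hur hM (z := z - c) (R := u / s) (by positivity)
    (by rw [div_mul_eq_mul_div, div_le_iff₀ hs]; gcongr) ((div_lt_one hu).2 hsu) (μ := 1)
    (by rw [norm_one]; field_simp; rfl) N
  rw [map_sum]
  simp_rw [heval]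
  refine le_trans (le_of_eq ?_) (hrem.trans hN.le)
  simp [hg_def]

/-- An algebra homomorphism into a Banach algebra that is bounded with respect to the norm of
`φ p` factors through a bounded homomorphism on the closure of the range of `φ`. -/
lemma AlgHom.exists_extend_topologicalClosure_range {P A B : Type*} [Ring P] [Algebra ℂ P]
    [NormedRing A] [NormedAlgebra ℂ A] [NormedRing B] [NormedAlgebra ℂ B] [CompleteSpace B]
    (φ : P →ₐ[ℂ] A) (ψ : P →ₐ[ℂ] B) {D : ℝ} (hD : ∀ p, ‖ψ p‖ ≤ D * ‖φ p‖) :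
    ∃ Φ : φ.range.topologicalClosure →ₐ[ℂ] B,
      (∀ p (hp : φ p ∈ φ.range.topologicalClosure), Φ ⟨φ p, hp⟩ = ψ p) ∧
      ∀ u, ‖Φ u‖ ≤ D * ‖u‖ := by
  set Γ := (φ.prod ψ).range.topologicalClosure with hΓ
  have hφψ : ∀ p, (φ p, ψ p) ∈ Γ := fun p =>
    Subalgebra.le_topologicalClosure _ ⟨p, rfl⟩
  have hbound : ∀ x ∈ Γ, ‖x.2‖ ≤ D * ‖x.1‖ := by
    intro x hx
    have hclosed : IsClosed {x : A × B | ‖x.2‖ ≤ D * ‖x.1‖} :=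
      isClosed_le (by fun_prop) (by fun_prop)
    refine closure_minimal ?_ hclosed hx
    rintro _ ⟨p, rfl⟩
    exact hD p
  have hunique : ∀ u x y, (u, x) ∈ Γ → (u, y) ∈ Γ → x = y := fun u x y hx hy => by
    have := hbound _ (Γ.sub_mem hx hy)
    simpa [sub_eq_zero] using this
  have hexists : ∀ u ∈ φ.range.topologicalClosure, ∃ x, (u, x) ∈ Γ := by
    intro u hu
    obtain ⟨s, hs, hsu⟩ := mem_closure_iff_seq_limit.1 hu
    choose p hp using hs
    have hp' : ∀ n, φ (p n) = s n := hp
    have hcauchy : CauchySeq fun n => ψ (p n) := by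
      rw [Metric.cauchySeq_iff']
      intro ε hε
      obtain ⟨N, hN⟩ := Metric.cauchySeq_iff'.1 hsu.cauchySeq (ε / (|D| + 1)) (by positivity)
      refine ⟨N, fun n hn => ?_⟩
      have h1 := hN n hn
      rw [lt_div_iff₀ (by positivity)] at h1
      rw [dist_eq_norm, ← map_sub]
      refine (hD _).trans_lt (lt_of_le_of_lt ?_ h1)
      rw [map_sub, hp', hp', ← dist_eq_norm, mul_comm]
      gcongr
      linarith [le_abs_self D]
    obtain ⟨x, hx⟩ := cauchySeq_tendsto_of_complete hcauchy
    refine ⟨x, ?_⟩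
    have hlim : Tendsto (fun n => (φ (p n), ψ (p n))) atTop (𝓝 (u, x)) := by
      simp_rw [hp']
      exact hsu.prodMk_nhds hx
    exact (Subalgebra.isClosed_topologicalClosure _).mem_of_tendsto hlim
      (Eventually.of_forall fun n => hφψ (p n))
  choose F hF using hexists
  have hFeq : ∀ u (hu : u ∈ φ.range.topologicalClosure) x, (u, x) ∈ Γ → F u hu = x :=
    fun u hu x hx => hunique u _ _ (hF u hu) hx
  refine ⟨{ toFun u := F u u.2
            map_one' := hFeq _ _ _ Γ.one_mem
            map_mul' u v := hFeq _ _ _ (Γ.mul_mem (hF u u.2) (hF v v.2))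
            map_zero' := hFeq _ _ _ Γ.zero_mem
            map_add' u v := hFeq _ _ _ (Γ.add_mem (hF u u.2) (hF v v.2))
            commutes' z := hFeq _ _ _ (Γ.algebraMap_mem z) },
    fun p hp => hFeq _ _ _ (hφψ p), fun u => hbound _ (hF u u.2)⟩

/-- Restriction of holomorphic functions on a ball to a subset, as continuous functions. -/
def HolBall.restrict {d : ℕ} {c : EuclideanSpace ℂ (Fin d)} {r : ℝ}
    {K : Set (EuclideanSpace ℂ (Fin d))} (hK : K ⊆ ball c r) : HolBall d c r →ₐ[ℂ] C(K, ℂ) where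
  toFun f := ⟨fun z => (f : EuclideanSpace ℂ (Fin d) → ℂ) z,
    continuousOn_iff_continuous_domRestrict.1
      ((show DifferentiableOn ℂ _ _ from f.2).continuousOn.mono hK)⟩
  map_one' := rfl
  map_mul' _ _ := rfl
  map_zero' := rfl
  map_add' _ _ := rfl
  commutes' _ := rfl

lemma MvPolynomial.eval_mem_HolBall {d : ℕ} (c : EuclideanSpace ℂ (Fin d)) (r : ℝ)
    (p : MvPolynomial (Fin d) ℂ) :
    (fun z : EuclideanSpace ℂ (Fin d) => MvPolynomial.eval (fun i => z i) p) ∈ HolBall d c r := by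
  induction p using MvPolynomial.induction_on with
  | C k =>
    simp_rw [MvPolynomial.eval_C]
    exact (HolBall d c r).algebraMap_mem k
  | add p q hp hq =>
    simp_rw [map_add]
    exact (HolBall d c r).add_mem hp hq
  | mul_X p i hp =>
    simp_rw [map_mul, MvPolynomial.eval_X]
    refine (HolBall d c r).mul_mem hp (y := fun z => z i) ?_
    change DifferentiableOn ℂ _ _
    fun_prop

/-- Two continuous extensions of the polynomial calculus agree. -/
lemma ExtendsPolynomialCalculus.unique {B : Type*} [NormedCommRing B] [NormedAlgebra ℂ B] {d : ℕ}
    {a : Fin d → B} {c : EuclideanSpace ℂ (Fin d)} {r : ℝ} (hr : 0 < r)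
    {Φ Ψ : HolBall d c r →ₐ[ℂ] B} (hΦ : ExtendsPolynomialCalculus Φ a)
    (hΦc : SeqContinuousOnCompacts Φ) (hΨ : ExtendsPolynomialCalculus Ψ a)
    (hΨc : SeqContinuousOnCompacts Ψ) : Φ = Ψ := by
  refine AlgHom.ext fun f => ?_
  have happrox : ∀ k : ℕ, ∃ p : MvPolynomial (Fin d) ℂ, ∀ z ∈ closedBall c (r - 1 / (k + 1)),
      ‖(f : EuclideanSpace ℂ (Fin d) → ℂ) z - MvPolynomial.eval (fun i => z i) p‖ ≤
        1 / (k + 1) := fun k =>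
    exists_mvPolynomial_norm_sub_le hr f.2 (sub_lt_self r (by positivity)) (by positivity)
  choose p hp using happrox
  have hlim : ∀ K : Set (EuclideanSpace ℂ (Fin d)), IsCompact K → K ⊆ ball c r →
      TendstoUniformlyOn (fun k z => ((⟨_, (p k).eval_mem_HolBall c r⟩ : HolBall d c r) :
        EuclideanSpace ℂ (Fin d) → ℂ) z) f atTop K := by
    intro K hK hKr
    obtain ⟨s, hsr, hKs⟩ := exists_lt_subset_ball hK.isClosed hKr
    rw [Metric.tendstoUniformlyOn_iff]
    intro ε hε
    filter_upwards [tendsto_one_div_add_atTop_nhds_zero_nat.eventually_lt_const hε,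
      tendsto_one_div_add_atTop_nhds_zero_nat.eventually_lt_const (sub_pos.2 hsr)] with k hkε hks z hz
    rw [dist_eq_norm]
    refine (hp k z (mem_closedBall.2 ?_)).trans_lt hkε
    linarith [mem_ball.1 (hKs hz)]
  refine tendsto_nhds_unique (hΦc _ f hlim) ((hΨc _ f hlim).congr fun k => ?_)
  rw [hΦ, hΨ]

/-- (Holomorphic functional calculus for balls.) If `𝔅` is a commutative unital Banach
algebra, `a ∈ 𝔅^d`, and `B ⊆ ℂ^d` is an open ball containing the joint spectrum of `a`,
then there is a unique unital `ℂ`-algebra homomorphism `Φ : O(B) → 𝔅` that extends the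
polynomial functional calculus `p ↦ p(a)` and is continuous with respect to uniform
convergence on compact subsets of `B`. -/
theorem holomorphic_functional_calculus_ball
    {B : Type*} [NormedCommRing B] [NormedAlgebra ℂ B] [CompleteSpace B]
    {d : ℕ} (a : Fin d → B) (c : EuclideanSpace ℂ (Fin d)) (r : ℝ) (hr : 0 < r)
    (hspec : jointSpectrum a ⊆ ball c r) :
    ∃! Φ : HolBall d c r →ₐ[ℂ] B,
      ExtendsPolynomialCalculus Φ a ∧ SeqContinuousOnCompacts Φ := by
  obtain ⟨t, ht, htr, D, hD, hDp⟩ := exists_norm_aeval_le_of_jointSpectrum_subset a c hr hspec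
  have hsub : closedBall c t ⊆ ball c r := closedBall_subset_ball htr
  have : CompactSpace (closedBall c t) := isCompact_iff_compactSpace.1 (isCompact_closedBall c t)
  set φ : MvPolynomial (Fin d) ℂ →ₐ[ℂ] C(closedBall c t, ℂ) :=
    MvPolynomial.aeval fun i => ⟨fun z => z.1 i, by fun_prop⟩
  have hφ : ∀ p z, φ p z = MvPolynomial.eval (fun i => z.1 i) p := fun p z => by
    rw [← MvPolynomial.coe_aeval_eq_eval]
    exact MvPolynomial.comp_aeval_apply _ (ContinuousMap.evalAlgHom ℂ ℂ z) p
  have hφres : ∀ p, HolBall.restrict hsub ⟨_, p.eval_mem_HolBall c r⟩ = φ p := fun p => by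
    ext z
    exact (hφ p z).symm
  obtain ⟨Ψ, hΨp, hΨ⟩ := φ.exists_extend_topologicalClosure_range (MvPolynomial.aeval a)
    (D := D) fun p => hDp p _ fun z hz => by
      rw [← hφ p ⟨z, hz⟩]
      exact (φ p).norm_coe_le_norm _
  have hmem : ∀ f : HolBall d c r, HolBall.restrict hsub f ∈ φ.range.topologicalClosure := by
    intro f
    refine Metric.mem_closure_iff.2 fun ε hε => ?_
    obtain ⟨p, hp⟩ := exists_mvPolynomial_norm_sub_le hr f.2 htr (half_pos hε)
    refine ⟨φ p, ⟨p, rfl⟩, ?_⟩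
    rw [dist_eq_norm]
    refine lt_of_le_of_lt ?_ (half_lt_self hε)
    refine (ContinuousMap.norm_le _ (half_pos hε).le).2 fun z => ?_
    rw [ContinuousMap.sub_apply, hφ]
    exact hp z z.2
  set Φ : HolBall d c r →ₐ[ℂ] B := Ψ.comp ((HolBall.restrict hsub).codRestrict _ hmem)
  have hΦ : ExtendsPolynomialCalculus Φ a := fun p hp => by
    rw [← hΨp p (hφres p ▸ hmem _)]
    exact congrArg Ψ (Subtype.ext (hφres p))
  have hΦc : SeqContinuousOnCompacts Φ := by
    intro F f hF
    have hres : Tendsto (fun k => HolBall.restrict hsub (F k)) atTop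
        (𝓝 (HolBall.restrict hsub f)) := by
      rw [ContinuousMap.tendsto_iff_tendstoUniformly]
      exact tendstoUniformlyOn_iff_tendstoUniformly_comp_coe.1
        (hF _ (isCompact_closedBall c t) hsub)
    rw [tendsto_iff_norm_sub_tendsto_zero] at hres ⊢
    refine squeeze_zero (fun _ => norm_nonneg _) (fun k => ?_) (by simpa using hres.const_mul D)
    rw [← map_sub, ← map_sub]
    exact hΨ _
  exact ⟨Φ, ⟨hΦ, hΦc⟩, fun Φ' h => h.1.unique hr h.2 hΦ hΦc⟩
end

section
/- Let 𝔅 be a commutative unital complex Banach algebra, let a = (a_1, …, a_d) ∈ 𝔅^d, and let B ⊆ ℂ^d be an open Euclidean ball containing σ_𝔅(a). Let Φ : O(B) → 𝔅 be a unital ℂ-algebra homomorphism such that Φ(p|_B) = p(a) for every polynomial p ∈ ℂ[z_1, …, z_d] and such that Φ(f_k) → Φ(f) whenever (f_k) in O(B) converges to f ∈ O(B) uniformly on compact subsets of B. Then for every k ∈ ℕ and all f_1, …, f_k ∈ O(B), writing f(a) := (Φ(f_1), …, Φ(f_k)) ∈ 𝔅^k, the joint spectrum satisfies σ_𝔅(f(a))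 = {(f_1(λ), …, f_k(λ)) : λ ∈ σ_𝔅(a)}. -/
open Metric

open Set Filter Topology MeasureTheory

section HolomorphicFunctions

variable {E : Type*} [NormedAddCommGroup E] [NormedSpace ℂ E]

/-- **Cauchy estimate** for the Fréchet derivative. -/
theorem norm_fderiv_le_of_norm_le_ball {f : E → ℂ} {x : E} {R C : ℝ} (hR : 0 < R)
    (hf : DifferentiableOn ℂ f (ball x R)) (hC : ∀ y ∈ ball x R, ‖f y‖ ≤ C) :
    ‖fderiv ℂ f x‖ ≤ 2 * C / R := by
  refine Complex.norm_fderiv_le_div_of_mapsTo_ball hf (fun y hy => ?_) hR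
  rw [mem_closedBall, dist_eq_norm]
  calc ‖f y - f x‖ ≤ ‖f y‖ + ‖f x‖ := norm_sub_le _ _
    _ ≤ 2 * C := by linarith [hC y hy, hC x (mem_ball_self hR)]

/-- A parametric integral of jointly continuous functions that are holomorphic in the space
variable is holomorphic. -/
theorem differentiableOn_intervalIntegral_of_continuousOn [FiniteDimensional ℂ E] {U : Set E}
    (hU : IsOpen U) {F : E → ℝ → ℂ} {a b : ℝ} (hab : a ≤ b)
    (hF : ContinuousOn (Function.uncurry F) (U ×ˢ Icc a b))
    (hd : ∀ t ∈ Icc a b, DifferentiableOn ℂ (fun x => F x t) U) :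
    DifferentiableOn ℂ (fun x => ∫ t in a..b, F x t) U := by
  intro x₀ hx₀
  have : ProperSpace E := FiniteDimensional.proper ℂ E
  obtain ⟨R, hR, hRU⟩ := nhds_basis_closedBall.mem_iff.1 (hU.mem_nhds hx₀)
  have hbU : ball x₀ R ⊆ U := ball_subset_closedBall.trans hRU
  have hK : IsCompact (closedBall x₀ R ×ˢ Icc a b) := (isCompact_closedBall x₀ R).prod isCompact_Icc
  have hFK : ContinuousOn (Function.uncurry F) (closedBall x₀ R ×ˢ Icc a b) :=
    hF.mono (prod_mono hRU Subset.rfl)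
  obtain ⟨M, hM⟩ := hK.exists_bound_of_continuousOn hFK
  have hFt : ∀ x ∈ U, ContinuousOn (F x) (Icc a b) := fun x hx =>
    hF.comp (f := fun t => (x, t)) (by fun_prop) fun t ht => ⟨hx, ht⟩
  have hIoc : Set.uIoc a b ⊆ Icc a b := by
    rw [uIoc_of_le hab]; exact Ioc_subset_Icc_self
  have hderiv : ContinuousOn (fun t => fderiv ℂ (fun x => F x t) x₀) (Icc a b) := by
    rw [Metric.continuousOn_iff]
    intro t ht ε hε
    obtain ⟨δ, hδ, hδF⟩ := Metric.uniformContinuousOn_iff.1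
      (hK.uniformContinuousOn_of_continuous hFK) (ε * R / 4) (by positivity)
    refine ⟨δ, hδ, fun s hs hst => ?_⟩
    have hdiff : ∀ u ∈ Icc a b, DifferentiableAt ℂ (fun x => F x u) x₀ := fun u hu =>
      (hd u hu).differentiableAt (hU.mem_nhds hx₀)
    rw [dist_eq_norm, ← fderiv_fun_sub (hdiff s hs) (hdiff t ht)]
    refine (norm_fderiv_le_of_norm_le_ball (C := ε * R / 4) hR
      (((hd s hs).sub (hd t ht)).mono hbU) fun y hy => ?_).trans_lt ?_
    · have hy' := ball_subset_closedBall hy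
      have := hδF (y, s) ⟨hy', hs⟩ (y, t) ⟨hy', ht⟩ (by simpa [Prod.dist_eq, hδ] using hst)
      rw [dist_eq_norm] at this
      exact this.le
    · rw [div_lt_iff₀ hR]
      nlinarith [mul_pos hε hR]
  have key := intervalIntegral.hasFDerivAt_integral_of_dominated_of_fderiv_le (𝕜 := ℂ)
    (μ := volume) (F := F) (F' := fun x t => fderiv ℂ (fun x => F x t) x) (a := a) (b := b)
    (x₀ := x₀) (s := ball x₀ (R / 2)) (bound := fun _ => 2 * M / (R / 2))
    (ball_mem_nhds _ (by positivity)) ?_ ?_ ?_ ?_ intervalIntegrable_const ?_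
  · exact key.differentiableAt.differentiableWithinAt
  · filter_upwards [hU.mem_nhds hx₀] with x hx
    exact ((hFt x hx).mono hIoc).aestronglyMeasurable measurableSet_uIoc
  · exact ((hFt x₀ hx₀).mono (uIcc_of_le hab).subset).intervalIntegrable
  · exact (hderiv.mono hIoc).aestronglyMeasurable measurableSet_uIoc
  · refine Eventually.of_forall fun t ht x hx => ?_
    have hsub : ball x (R / 2) ⊆ ball x₀ R := ball_subset_ball' (by
      rw [mem_ball] at hx; linarith)
    exact norm_fderiv_le_of_norm_le_ball (by positivity)
      ((hd t (hIoc ht)).mono (hsub.trans hbU))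
      fun y hy => hM (y, t) ⟨ball_subset_closedBall (hsub hy), hIoc ht⟩
  · refine Eventually.of_forall fun t ht x hx => ?_
    have hxU : x ∈ U := hbU (ball_subset_ball (by linarith) hx)
    exact ((hd t (hIoc ht)).differentiableAt (hU.mem_nhds hxU)).hasFDerivAt

/-- Directional derivatives of holomorphic functions on a finite-dimensional space are
holomorphic. -/
theorem DifferentiableOn.fderiv_apply_const [FiniteDimensional ℂ E] {U : Set E} (hU : IsOpen U)
    {f : E → ℂ} (hf : DifferentiableOn ℂ f U) (v : E) :
    DifferentiableOn ℂ (fun x => fderiv ℂ f x v) U := by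
  intro x₀ hx₀
  obtain ⟨R, hR, hRU⟩ := Metric.isOpen_iff.1 hU x₀ hx₀
  set ρ : ℝ := R / (2 * (‖v‖ + 1))
  have hv : 0 < ‖v‖ + 1 := by positivity
  have hρ : 0 < ρ := by positivity
  have hmem : ∀ x ∈ ball x₀ (R / 2), ∀ ζ ∈ closedBall (0 : ℂ) ρ, x + ζ • v ∈ U := by
    intro x hx ζ hζ
    apply hRU
    rw [mem_ball, dist_eq_norm] at hx ⊢
    rw [mem_closedBall, dist_zero_right] at hζ
    have h₁ : ‖ζ • v‖ ≤ R / 2 := by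
      rw [norm_smul]
      calc ‖ζ‖ * ‖v‖ ≤ ρ * (‖v‖ + 1) := by gcongr; linarith
        _ = R / 2 := by simp only [ρ]; field_simp
    calc ‖x + ζ • v - x₀‖ = ‖(x - x₀) + ζ • v‖ := by congr 1; abel
      _ ≤ ‖x - x₀‖ + ‖ζ • v‖ := norm_add_le _ _
      _ < R := by linarith
  have hcauchy : ∀ x ∈ ball x₀ (R / 2), fderiv ℂ f x v =
      Complex.cderiv ρ (fun ζ : ℂ => f (x + ζ • v)) 0 := by
    intro x hx
    have hlin : Continuous fun ζ : ℂ => x + ζ • v := by fun_prop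
    have hcomp : DifferentiableOn ℂ (fun ζ : ℂ => f (x + ζ • v))
        ((fun ζ : ℂ => x + ζ • v) ⁻¹' U) :=
      hf.comp (by fun_prop) (mapsTo_preimage _ _)
    rw [Complex.cderiv_eq_deriv (hU.preimage hlin) hcomp hρ (hmem x hx)]
    have hxU : x ∈ U := by simpa using hmem x hx 0 (mem_closedBall_self hρ.le)
    have hline : HasDerivAt (fun ζ : ℂ => x + ζ • v) v 0 := by
      simpa using ((hasDerivAt_id (0 : ℂ)).smul_const v).const_add x
    have hfx : HasFDerivAt f (fderiv ℂ f x) (x + (0 : ℂ) • v) := by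
      simpa using (hf.differentiableAt (hU.mem_nhds hxU)).hasFDerivAt
    exact (hfx.comp_hasDerivAt (0 : ℂ) hline).deriv.symm
  have hcircle : ∀ θ : ℝ, circleMap 0 ρ θ ∈ closedBall (0 : ℂ) ρ := fun θ =>
    circleMap_mem_closedBall 0 hρ.le θ
  have hint : DifferentiableOn ℂ
      (fun x => Complex.cderiv ρ (fun ζ : ℂ => f (x + ζ • v)) 0) (ball x₀ (R / 2)) := by
    simp only [Complex.cderiv, circleIntegral]
    refine DifferentiableOn.fun_const_smul (differentiableOn_intervalIntegral_of_continuousOn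
      isOpen_ball Real.two_pi_pos.le ?_ fun t _ => ?_) _
    · have h₁ : ContinuousOn (fun p : E × ℝ => f (p.1 + circleMap 0 ρ p.2 • v))
          (ball x₀ (R / 2) ×ˢ Icc 0 (2 * Real.pi)) :=
        hf.continuousOn.comp (by fun_prop) fun p hp => hmem p.1 hp.1 _ (hcircle p.2)
      have h₂ : Continuous fun p : E × ℝ => ((circleMap 0 ρ p.2 - 0) ^ 2)⁻¹ := by
        refine Continuous.inv₀ (by fun_prop) fun p => ?_
        simpa using hρ.ne'
      have h₃ : Continuous fun p : E × ℝ => _root_.deriv (circleMap 0 ρ) p.2 := by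
        simp only [deriv_circleMap]
        fun_prop
      exact h₃.continuousOn.smul (h₂.continuousOn.smul h₁)
    · have h₁ : DifferentiableOn ℂ (fun x => f (x + circleMap 0 ρ t • v)) (ball x₀ (R / 2)) :=
        hf.comp (by fun_prop) fun x hx => hmem x hx _ (hcircle t)
      exact (h₁.fun_const_smul _).fun_const_smul _
  have hnhds : ball x₀ (R / 2) ∈ 𝓝 x₀ := ball_mem_nhds _ (by positivity)
  refine DifferentiableAt.differentiableWithinAt ?_
  exact (hint.differentiableAt hnhds).congr_of_eventuallyEq
    (by filter_upwards [hnhds] with x hx using hcauchy x hx)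

/-- **Hefer–Gleason decomposition** on a convex open set, with respect to a basis. -/
theorem Convex.exists_differentiableOn_sub_eq_sum {ι : Type*} [Fintype ι] (e : Module.Basis ι ℂ E)
    {U : Set E} (hU : IsOpen U) (hconv : Convex ℝ U) {f : E → ℂ} (hf : DifferentiableOn ℂ f U)
    {w : E} (hw : w ∈ U) :
    ∃ g : ι → E → ℂ, (∀ i, DifferentiableOn ℂ (g i) U) ∧
      ∀ z ∈ U, f z - f w = ∑ i, e.repr (z - w) i * g i z := by
  have : FiniteDimensional ℂ E := e.finiteDimensional_of_finite
  have hmem : ∀ z ∈ U, ∀ t ∈ Icc (0 : ℝ) 1, w + (t : ℂ) • (z - w) ∈ U := fun z hz t ht => by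
    rw [Complex.coe_smul]
    exact hconv.add_smul_sub_mem hw hz ht
  have hcont : ∀ v, ContinuousOn
      (fun p : E × ℝ => fderiv ℂ f (w + (p.2 : ℂ) • (p.1 - w)) v) (U ×ˢ Icc 0 1) := fun v =>
    (hf.fderiv_apply_const hU v).continuousOn.comp (by fun_prop)
      fun p hp => hmem p.1 hp.1 p.2 hp.2
  have hcont_right : ∀ v, ∀ z ∈ U, ContinuousOn
      (fun t : ℝ => fderiv ℂ f (w + (t : ℂ) • (z - w)) v) (uIcc 0 1) := fun v z hz => by
    rw [uIcc_of_le zero_le_one]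
    exact (hcont v).comp (f := fun t => (z, t)) (by fun_prop) fun t ht => ⟨hz, ht⟩
  refine ⟨fun i z => ∫ t in (0 : ℝ)..1, fderiv ℂ f (w + (t : ℂ) • (z - w)) (e i),
    fun i => ?_, fun z hz => ?_⟩
  · exact differentiableOn_intervalIntegral_of_continuousOn hU zero_le_one (hcont (e i))
      fun t ht => (hf.fderiv_apply_const hU (e i)).comp (by fun_prop) fun z hz => hmem z hz t ht
  · have hFTC := intervalIntegral.integral_eq_sub_of_hasDerivAt (a := 0) (b := 1)
      (f := fun t : ℝ => f (w + (t : ℂ) • (z - w)))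
      (f' := fun t : ℝ => fderiv ℂ f (w + (t : ℂ) • (z - w)) (z - w)) (fun t ht => ?_)
      (hcont_right _ z hz).intervalIntegrable
    · simp only [Complex.ofReal_one, one_smul, Complex.ofReal_zero, zero_smul, add_zero,
        add_sub_cancel] at hFTC
      rw [← hFTC]
      simp_rw [← intervalIntegral.integral_const_mul]
      rw [← intervalIntegral.integral_finsetSum fun i _ =>
        ((hcont_right (e i) z hz).intervalIntegrable).const_mul _]
      congr 1 with t
      generalize fderiv ℂ f (w + (t : ℂ) • (z - w)) = L
      conv_lhs => rw [← e.sum_repr (z - w)]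
      simp only [map_sum, map_smul, smul_eq_mul]
    · rw [uIcc_of_le zero_le_one] at ht
      have hfx := (hf.differentiableAt (hU.mem_nhds (hmem z hz t ht))).hasFDerivAt
      have hline : HasDerivAt (fun ζ : ℂ => w + ζ • (z - w)) (z - w) (t : ℂ) := by
        simpa using ((hasDerivAt_id (t : ℂ)).smul_const (z - w)).const_add w
      exact (hfx.comp_hasDerivAt (t : ℂ) hline).comp_ofReal

end HolomorphicFunctions

section FunctionalCalculus

variable {B : Type*} [NormedCommRing B] [NormedAlgebra ℂ B] {d : ℕ}
  {c : EuclideanSpace ℂ (Fin d)} {r : ℝ} {Φ : HolBall d c r →ₐ[ℂ] B}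

/-- A continuous functional calculus only sees the restriction to the ball. -/
theorem SeqContinuousOnCompacts.map_congr (hcont : SeqContinuousOnCompacts Φ)
    {f g : HolBall d c r}
    (hfg : EqOn (f : EuclideanSpace ℂ (Fin d) → ℂ) g (ball c r)) : Φ f = Φ g := by
  refine tendsto_nhds_unique tendsto_const_nhds
    (hcont (fun _ => f) g fun K _ hK => ?_)
  rw [Metric.tendstoUniformlyOn_iff]
  intro ε hε
  refine Eventually.of_forall fun _ x hx => ?_
  simpa [hfg (hK hx)] using hε

/-- The function `z ↦ z i - w` as an element of `HolBall`. -/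
def HolBall.coordSub (c : EuclideanSpace ℂ (Fin d)) (r : ℝ) (i : Fin d) (w : ℂ) :
    HolBall d c r :=
  ⟨fun z => z i - w, by
    have : Differentiable ℂ fun z : EuclideanSpace ℂ (Fin d) => z i - w := by fun_prop
    exact this.differentiableOn⟩

theorem ExtendsPolynomialCalculus.map_coordSub {a : Fin d → B}
    (hpoly : ExtendsPolynomialCalculus Φ a) (i : Fin d) (w : ℂ) :
    Φ (HolBall.coordSub c r i w) = a i - algebraMap ℂ B w := by
  have heq : (fun z : EuclideanSpace ℂ (Fin d) => MvPolynomial.eval (fun i => z i)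
      (MvPolynomial.X i - MvPolynomial.C w : MvPolynomial (Fin d) ℂ)) =
      (HolBall.coordSub c r i w : EuclideanSpace ℂ (Fin d) → ℂ) := by
    ext z
    simp [HolBall.coordSub]
  have hmem := (HolBall.coordSub c r i w).2
  rw [← heq] at hmem
  calc Φ (HolBall.coordSub c r i w) = Φ ⟨_, hmem⟩ := congrArg Φ (Subtype.ext heq.symm)
    _ = _ := by rw [hpoly _ hmem]; simp

/-- A character composed with the functional calculus is evaluation at the corresponding point of
the joint spectrum. -/
theorem ExtendsPolynomialCalculus.character_apply {a : Fin d → B}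
    (hpoly : ExtendsPolynomialCalculus Φ a) (hcont : SeqContinuousOnCompacts Φ)
    (χ : B →ₐ[ℂ] ℂ) {w : EuclideanSpace ℂ (Fin d)} (hw : w ∈ ball c r)
    (hχ : ∀ i, χ (a i) = w i) (f : HolBall d c r) :
    χ (Φ f) = (f : EuclideanSpace ℂ (Fin d) → ℂ) w := by
  obtain ⟨g, hg, hfg⟩ := (convex_ball c r).exists_differentiableOn_sub_eq_sum
    (EuclideanSpace.basisFun (Fin d) ℂ).toBasis isOpen_ball f.2 hw
  have hdecomp : Φ f = Φ (algebraMap ℂ _ ((f : EuclideanSpace ℂ (Fin d) → ℂ) w) +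
      ∑ i, HolBall.coordSub c r i (w i) * ⟨g i, hg i⟩) := by
    refine hcont.map_congr fun z hz => ?_
    have := hfg z hz
    simp only [OrthonormalBasis.coe_toBasis_repr_apply, EuclideanSpace.basisFun_repr,
      PiLp.sub_apply] at this
    simp [HolBall.coordSub, ← this]
  rw [hdecomp, map_add, map_sum, map_add, map_sum, AlgHom.commutes, AlgHom.commutes]
  simp [hpoly.map_coordSub, hχ]

end FunctionalCalculus

/-- (Spectral mapping / superposition principle.) Let `𝔅` be a commutative unital Banach
algebra, `a ∈ 𝔅^d`, and `B ⊆ ℂ^d` an open ball containing the joint spectrum of `a`. If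
`Φ : O(B) → 𝔅` is a unital `ℂ`-algebra homomorphism extending the polynomial functional
calculus of `a` and continuous for uniform convergence on compacts, then for all
`f₁, …, f_k ∈ O(B)`, the joint spectrum of `f(a) := (Φ(f₁), …, Φ(f_k))` equals the image
of the joint spectrum of `a` under `λ ↦ (f₁(λ), …, f_k(λ))`. -/
theorem jointSpectrum_mapping
    {B : Type*} [NormedCommRing B] [NormedAlgebra ℂ B] [CompleteSpace B]
    {d : ℕ} (a : Fin d → B) (c : EuclideanSpace ℂ (Fin d)) (r : ℝ) (hr : 0 < r)
    (hspec : jointSpectrum a ⊆ ball c r)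
    (Φ : HolBall d c r →ₐ[ℂ] B)
    (hpoly : ExtendsPolynomialCalculus Φ a)
    (hcont : SeqContinuousOnCompacts Φ)
    (k : ℕ) (f : Fin k → HolBall d c r) :
    jointSpectrum (fun j => Φ (f j)) =
      {w : EuclideanSpace ℂ (Fin k) |
        ∃ lam ∈ jointSpectrum a, ∀ j, (f j : EuclideanSpace ℂ (Fin d) → ℂ) lam = w j} := by
  ext w
  constructor
  · rintro ⟨χ, hχ⟩
    have hmem : WithLp.toLp 2 (fun i => χ (a i)) ∈ jointSpectrum a := ⟨χ, fun _ => rfl⟩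
    refine ⟨_, hmem, fun j => ?_⟩
    rw [← hχ j, hpoly.character_apply hcont χ (hspec hmem) fun _ => rfl]
  · rintro ⟨lam, ⟨χ, hχ⟩, hw⟩
    refine ⟨χ, fun j => ?_⟩
    rw [hpoly.character_apply hcont χ (hspec ⟨χ, hχ⟩) hχ, hw j]
end
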